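/- arXiv:1605.06912 — 5 statements merged into one kernel-verified Lean document; each statement's English description precedes it below -/
import Mathlib

section
/- Let 0 < α < 1. Then δ₁ = 2^{−α} + 4ζ(α) − 4ζ(α−1) < 0, where ζ is the Riemann zeta function (note ζ(α) and ζ(α−1) are values of the analytic continuation at real arguments in (0,1) and (−1,0) respectively, and are real). -/
/-- Real values of the Riemann zeta function at real arguments
(real part of the analytic continuation). -/
noncomputable def zr (s : ℝ) : ℝ := (riemannZeta s).re

open Filter Topology Set

/-- `s - 1` times the error of the trapezoidal rule for `∫ x ^ (-s)` over `[n + 1, n + 2]`. -/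
noncomputable def trapezoidTerm (s : ℂ) (n : ℕ) : ℂ :=
  (s - 1) / 2 * ((n + 1 : ℂ) ^ (-s) + (n + 2 : ℂ) ^ (-s))
    + ((n + 2 : ℂ) ^ (1 - s) - (n + 1 : ℂ) ^ (1 - s))

/-- The real version of `trapezoidTerm`. -/
noncomputable def realTrapezoidTerm (s : ℝ) (n : ℕ) : ℝ :=
  (s - 1) / 2 * ((n + 1 : ℝ) ^ (-s) + (n + 2 : ℝ) ^ (-s))
    + ((n + 2 : ℝ) ^ (1 - s) - (n + 1 : ℝ) ^ (1 - s))

lemma trapezoidTerm_ofReal (s : ℝ) (n : ℕ) :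
    trapezoidTerm s n = (realTrapezoidTerm s n : ℂ) := by
  have h1 : (0 : ℝ) ≤ n + 1 := by positivity
  have h2 : (0 : ℝ) ≤ n + 2 := by positivity
  simp only [trapezoidTerm, realTrapezoidTerm]
  push_cast [Complex.ofReal_cpow h1, Complex.ofReal_cpow h2]
  rfl

lemma hasDerivAt_trapezoid_kernel (s a : ℂ) {z : ℂ} (hz : z ∈ Complex.slitPlane) :
    HasDerivAt (fun z : ℂ ↦ -s * (s - 1) * ((z - a) * (a + 1 - z) / 2) * z ^ (-s - 1)
        - (s - 1) * ((2 * a + 1 - 2 * z) / 2) * z ^ (-s) + z ^ (1 - s))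
      ((s - 1) * s * (s + 1) * ((z - a) * (a + 1 - z) / 2) * z ^ (-s - 2)) z := by
  have hz0 : z ≠ 0 := Complex.slitPlane_ne_zero hz
  have hp (c : ℂ) : HasDerivAt (fun z : ℂ ↦ z ^ c) (c * z ^ (c - 1)) z := by
    simpa using (hasDerivAt_id z).cpow_const (c := c) hz
  have hK : HasDerivAt (fun z : ℂ ↦ (z - a) * (a + 1 - z) / 2) ((2 * a + 1 - 2 * z) / 2) z := by
    refine ((((hasDerivAt_id' z).sub_const a).fun_mul
      ((hasDerivAt_id' z).const_sub (a + 1))).div_const 2).congr_deriv ?_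
    ring
  have hK' : HasDerivAt (fun z : ℂ ↦ (2 * a + 1 - 2 * z) / 2) (-1) z := by
    refine ((((hasDerivAt_id' z).const_mul 2).const_sub (2 * a + 1)).div_const 2).congr_deriv ?_
    ring
  refine ((((hK.const_mul (-s * (s - 1))).fun_mul (hp (-s - 1))).fun_sub
    ((hK'.const_mul (s - 1)).fun_mul (hp (-s)))).fun_add (hp (1 - s))).congr_deriv ?_
  have e1 : z ^ (-s - 1) = z ^ (-s - 2) * z := by
    rw [show -s - 1 = -s - 2 + 1 by ring, Complex.cpow_add _ _ hz0, Complex.cpow_one]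
  have e0 : z ^ (-s) = z ^ (-s - 2) * z * z := by
    rw [← e1, show -s = -s - 1 + 1 by ring, Complex.cpow_add _ _ hz0, Complex.cpow_one]
    ring_nf
  have e2 : z ^ (-s - 1 - 1) = z ^ (-s - 2) := by ring_nf
  have e3 : z ^ (1 - s - 1) = z ^ (-s) := by ring_nf
  rw [e2, e3, e0, e1]
  ring

lemma hasDerivAt_real_trapezoid_kernel (s a : ℝ) {x : ℝ} (hx : 0 < x) :
    HasDerivAt (fun z : ℝ ↦ -s * (s - 1) * ((z - a) * (a + 1 - z) / 2) * z ^ (-s - 1)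
        - (s - 1) * ((2 * a + 1 - 2 * z) / 2) * z ^ (-s) + z ^ (1 - s))
      ((s - 1) * s * (s + 1) * ((x - a) * (a + 1 - x) / 2) * x ^ (-s - 2)) x := by
  have h := (hasDerivAt_trapezoid_kernel s a
    (Complex.ofReal_mem_slitPlane.mpr hx)).real_of_complex
  have hre (z : ℝ) (hz : 0 < z) (c : ℝ) : (z : ℂ) ^ (c : ℂ) = ((z ^ c : ℝ) : ℂ) :=
    (Complex.ofReal_cpow hz.le c).symm
  refine (h.congr_of_eventuallyEq ?_).congr_deriv ?_
  · filter_upwards [lt_mem_nhds hx] with z hz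
    rw [← Complex.ofReal_re (_ + z ^ (1 - s))]
    push_cast [Complex.ofReal_cpow hz.le]
    rfl
  · rw [← Complex.ofReal_re ((s - 1) * s * _ * _ * _)]
    push_cast [Complex.ofReal_cpow hx.le]
    rfl

lemma norm_trapezoidTerm_le {s : ℂ} (hs : -2 ≤ s.re) (n : ℕ) :
    ‖trapezoidTerm s n‖ ≤ ‖s - 1‖ * ‖s‖ * ‖s + 1‖ / 8 * (n + 1 : ℝ) ^ (-s.re - 2) := by
  have hn : (0 : ℝ) < n + 1 := by positivity
  have key := norm_image_sub_le_of_norm_deriv_le_segment' (a := (n + 1 : ℝ)) (b := n + 2)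
    (C := ‖s - 1‖ * ‖s‖ * ‖s + 1‖ / 8 * (n + 1 : ℝ) ^ (-s.re - 2))
    (fun x hx ↦ (hasDerivAt_trapezoid_kernel s (n + 1)
      (Complex.ofReal_mem_slitPlane.mpr (hn.trans_le hx.1))).comp_ofReal.hasDerivWithinAt)
    (fun x hx ↦ ?_) (n + 2) (by constructor <;> linarith)
  · convert key using 1
    · push_cast
      simp only [trapezoidTerm]
      ring_nf
    · ring
  · have hx0 : 0 < x := hn.trans_le hx.1
    have hK : ‖((x : ℂ) - (n + 1)) * (n + 1 + 1 - x) / 2‖ ≤ 1 / 8 := by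
      have : ((x : ℂ) - (n + 1)) * (n + 1 + 1 - x) / 2
          = (((x - (n + 1)) * (n + 1 + 1 - x) / 2 : ℝ) : ℂ) := by push_cast; ring
      rw [this, Complex.norm_real, Real.norm_eq_abs, abs_of_nonneg]
      · nlinarith [sq_nonneg (2 * (x - (n + 1)) - 1)]
      · have := hx.1
        have := hx.2
        have := mul_nonneg (by linarith : 0 ≤ x - (n + 1)) (by linarith : 0 ≤ n + 1 + 1 - x)
        linarith
    have hpow : ‖(x : ℂ) ^ (-s - 2)‖ ≤ (n + 1 : ℝ) ^ (-s.re - 2) := by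
      rw [Complex.norm_cpow_eq_rpow_re_of_pos hx0]
      simpa using Real.rpow_le_rpow_of_nonpos hn hx.1 (by linarith : -s.re - 2 ≤ 0)
    rw [norm_mul, norm_mul, norm_mul, norm_mul]
    calc _ ≤ ‖s - 1‖ * ‖s‖ * ‖s + 1‖ * (1 / 8) * (n + 1 : ℝ) ^ (-s.re - 2) := by gcongr
      _ = _ := by ring

lemma hasSum_trapezoidTerm_of_one_lt_re {s : ℂ} (hs : 1 < s.re) :
    HasSum (trapezoidTerm s) ((s - 1) * riemannZeta s - (s - 1) / 2 - 1) := by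
  have hsum : Summable (fun n : ℕ ↦ (n + 1 : ℂ) ^ (-s)) := by
    have := (summable_nat_add_iff 1).mpr (Complex.summable_one_div_nat_cpow.mpr hs)
    simpa [Complex.cpow_neg] using this
  have h1 : HasSum (fun n : ℕ ↦ (n + 1 : ℂ) ^ (-s)) (riemannZeta s) := by
    rw [zeta_eq_tsum_one_div_nat_add_one_cpow hs]
    simpa [Complex.cpow_neg] using hsum.hasSum
  have h2 : HasSum (fun n : ℕ ↦ (n + 2 : ℂ) ^ (-s)) (riemannZeta s - 1) := by
    have := (hasSum_nat_add_iff' 1).mpr h1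
    simpa [add_assoc, one_add_one_eq_two] using this
  have hterm : Summable (trapezoidTerm s) := by
    refine Summable.of_norm_bounded ?_ fun n ↦ norm_trapezoidTerm_le (by linarith) n
    refine Summable.mul_left _ ?_
    have := (summable_nat_add_iff 1).mpr
      (Real.summable_nat_rpow.mpr (by linarith : -s.re - 2 < -1))
    simpa using this
  have h12 := (h1.add h2).mul_left ((s - 1) / 2)
  have h3 : HasSum (fun n : ℕ ↦ (n + 2 : ℂ) ^ (1 - s) - (n + 1 : ℂ) ^ (1 - s)) (-1) := by
    have hsm : Summable (fun n : ℕ ↦ (n + 2 : ℂ) ^ (1 - s) - (n + 1 : ℂ) ^ (1 - s)) := by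
      refine (hterm.sub h12.summable).congr fun n ↦ ?_
      simp only [trapezoidTerm]
      ring
    rw [hsm.hasSum_iff_tendsto_nat]
    have heq (N : ℕ) : ∑ n ∈ Finset.range N, ((n + 2 : ℂ) ^ (1 - s) - (n + 1 : ℂ) ^ (1 - s))
        = (N + 1 : ℂ) ^ (1 - s) - 1 := by
      have := Finset.sum_range_sub (fun n : ℕ ↦ (n + 1 : ℂ) ^ (1 - s)) N
      simpa [add_assoc, one_add_one_eq_two] using this
    simp_rw [heq]
    have hz : Tendsto (fun N : ℕ ↦ (N + 1 : ℂ) ^ (1 - s)) atTop (𝓝 0) := by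
      rw [tendsto_zero_iff_norm_tendsto_zero]
      have ht := ((tendsto_rpow_neg_atTop (by linarith : 0 < s.re - 1)).comp
        tendsto_natCast_atTop_atTop).comp (tendsto_add_atTop_nat 1)
      refine ht.congr fun N ↦ ?_
      have := Complex.norm_cpow_eq_rpow_re_of_pos (by positivity : (0 : ℝ) < N + 1) (1 - s)
      push_cast at this
      simp [this]
    simpa using hz.sub_const 1
  have h := h12.add h3
  rwa [show (s - 1) / 2 * (riemannZeta s + (riemannZeta s - 1)) + -1
    = (s - 1) * riemannZeta s - (s - 1) / 2 - 1 by ring] at h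

/-- The trapezoidal Euler-Maclaurin formula for `ζ`, valid to the right of `-1`. -/
lemma hasSum_trapezoidTerm {s : ℝ} (hs : s ∈ Ioo (-1 : ℝ) 1) :
    HasSum (trapezoidTerm s) ((s - 1) * riemannZeta s - (s - 1) / 2 - 1) := by
  obtain ⟨hs1, hs2⟩ := hs
  set U : Set ℂ := {z | (s - 1) / 2 < z.re} ∩ Metric.ball 0 3
  have hUo : IsOpen U := (isOpen_lt continuous_const Complex.continuous_re).inter
    Metric.isOpen_ball
  have hUc : IsPreconnected U :=
    ((convex_halfSpace_re_gt _).inter (convex_ball 0 3)).isPreconnected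
  have hbound (n : ℕ) (z : ℂ) (hz : z ∈ U) :
      ‖trapezoidTerm z n‖ ≤ 6 * ((n + 1 : ℕ) : ℝ) ^ (-(s - 1) / 2 - 2) := by
    obtain ⟨hz1, hz2⟩ := hz
    simp only [mem_ofPred_eq] at hz1
    rw [mem_ball_zero_iff] at hz2
    refine (norm_trapezoidTerm_le (by linarith) n).trans ?_
    have hm : ‖z - 1‖ ≤ 4 := (norm_sub_le _ _).trans (by simp; linarith)
    have hp : ‖z + 1‖ ≤ 4 := (norm_add_le _ _).trans (by simp; linarith)
    have hr : ((n : ℝ) + 1) ^ (-z.re - 2) ≤ ((n + 1 : ℕ) : ℝ) ^ (-(s - 1) / 2 - 2) := by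
      push_cast
      exact Real.rpow_le_rpow_of_exponent_le (by linarith [n.cast_nonneg (α := ℝ)])
        (by linarith)
    calc _ ≤ 4 * 3 * 4 / 8 * ((n + 1 : ℕ) : ℝ) ^ (-(s - 1) / 2 - 2) := by gcongr
      _ = _ := by norm_num
  have hsumm : Summable fun n : ℕ ↦ 6 * ((n + 1 : ℕ) : ℝ) ^ (-(s - 1) / 2 - 2) :=
    ((summable_nat_add_iff 1).mpr
      (Real.summable_nat_rpow.mpr (by linarith : -(s - 1) / 2 - 2 < -1))).mul_left 6
  have hdiff : DifferentiableOn ℂ (fun z ↦ ∑' n, trapezoidTerm z n) U := by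
    refine Complex.differentiableOn_tsum_of_summable_norm hsumm (fun n ↦ ?_) hUo hbound
    have h1 : (n + 1 : ℂ) ≠ 0 := by exact_mod_cast n.succ_ne_zero
    have h2 : (n + 2 : ℂ) ≠ 0 := by exact_mod_cast (n + 1).succ_ne_zero
    have : Differentiable ℂ fun z ↦ trapezoidTerm z n := by
      unfold trapezoidTerm
      intro z
      refine DifferentiableAt.add (DifferentiableAt.mul (by fun_prop) (.add ?_ ?_)) (.sub ?_ ?_)
      · exact DifferentiableAt.const_cpow (by fun_prop) (.inl h1)
      · exact DifferentiableAt.const_cpow (by fun_prop) (.inl h2)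
      · exact DifferentiableAt.const_cpow (by fun_prop) (.inl h2)
      · exact DifferentiableAt.const_cpow (by fun_prop) (.inl h1)
    exact this.differentiableOn
  have hdiff' : DifferentiableOn ℂ (fun z ↦ riemannZeta₁ z - (z - 1) / 2 - 1) U := by
    fun_prop
  have hmul (z : ℂ) (hz : z ≠ 1) : riemannZeta₁ z = (z - 1) * riemannZeta z := by
    rw [riemannZeta_eq_inv_sub_mul hz, mul_inv_cancel_left₀ (sub_ne_zero.mpr hz)]
  have h2U : (2 : ℂ) ∈ U := by
    refine ⟨?_, by simp; norm_num⟩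
    simp only [mem_ofPred_eq, Complex.re_ofNat]
    linarith
  have heq := (hdiff.analyticOnNhd hUo).eqOn_of_preconnected_of_eventuallyEq
    (hdiff'.analyticOnNhd hUo) hUc h2U (by
      filter_upwards [(isOpen_lt continuous_const Complex.continuous_re).mem_nhds
        (show (2 : ℂ) ∈ {z : ℂ | 1 < z.re} by simp)] with z hz
      rw [hmul z (by rintro rfl; simp at hz), (hasSum_trapezoidTerm_of_one_lt_re hz).tsum_eq])
  have hsU : (s : ℂ) ∈ U := by
    refine ⟨by simp only [mem_ofPred_eq, Complex.ofReal_re]; linarith, ?_⟩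
    rw [mem_ball_zero_iff, Complex.norm_real, Real.norm_eq_abs, abs_lt]
    constructor <;> linarith
  have hval := heq hsU
  simp only at hval
  rw [hmul _ (by exact_mod_cast hs2.ne)] at hval
  rw [← hval]
  exact (Summable.of_norm_bounded hsumm fun n ↦ hbound n s hsU).hasSum

lemma hasSum_realTrapezoidTerm {s : ℝ} (hs : s ∈ Ioo (-1 : ℝ) 1) :
    HasSum (realTrapezoidTerm s) ((s - 1) * zr s - (s - 1) / 2 - 1) := by
  have h := Complex.hasSum_re (hasSum_trapezoidTerm hs)
  convert h using 1
  · ext n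
    rw [trapezoidTerm_ofReal, Complex.ofReal_re]
  · have : (((s : ℂ) - 1) * riemannZeta s - (s - 1) / 2 - 1)
        = ((s - 1 : ℝ) : ℂ) * riemannZeta s - (((s - 1) / 2 + 1 : ℝ) : ℂ) := by
      push_cast; ring
    rw [this, Complex.sub_re, Complex.re_ofReal_mul, Complex.ofReal_re, zr]
    ring

lemma mul_realTrapezoidTerm_le {s : ℝ} (hs : s ∈ Ioo (-1 : ℝ) 1) (n : ℕ) :
    s * realTrapezoidTerm s n ≥
      s ^ 2 * (s - 1) / 8 * ((n + 1 : ℝ) ^ (-s - 1) - (n + 2 : ℝ) ^ (-s - 1)) := by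
  have hn : (0 : ℝ) < n + 1 := by positivity
  have hd (x : ℝ) (hx : x ∈ Icc (n + 1 : ℝ) (n + 2)) :=
    ((hasDerivAt_real_trapezoid_kernel s (n + 1) (hn.trans_le hx.1)).const_mul s).add
      ((Real.hasDerivAt_rpow_const (p := -s - 1)
        (.inl (hn.trans_le hx.1).ne')).const_mul (s ^ 2 * (s - 1) / 8))
  have hmono := monotoneOn_of_hasDerivWithinAt_nonneg (convex_Icc (n + 1 : ℝ) (n + 2))
    (fun x hx ↦ (hd x hx).continuousAt.continuousWithinAt)
    (fun x hx ↦ (hd x (interior_subset hx)).hasDerivWithinAt) (fun x hx ↦ by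
      have hx' := interior_subset hx
      have hpow : 0 < x ^ (-s - 2) := Real.rpow_pos_of_pos (hn.trans_le hx'.1) _
      have e : x ^ (-s - 1 - 1) = x ^ (-s - 2) := by ring_nf
      rw [e]
      have hc : 0 ≤ s ^ 2 * (1 - s) * (s + 1) * x ^ (-s - 2) := by
        have := hs.1
        have := hs.2
        have h1 : 0 ≤ 1 - s := by linarith
        have h2 : 0 ≤ s + 1 := by linarith
        positivity
      have hK : 0 ≤ 1 / 8 - (x - (n + 1)) * (n + 1 + 1 - x) / 2 := by
        nlinarith [sq_nonneg (2 * (x - (n + 1)) - 1)]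
      calc 0 ≤ _ := mul_nonneg hc hK
        _ = _ := by ring)
  have h := hmono (left_mem_Icc.mpr (by linarith)) (right_mem_Icc.mpr (by linarith))
    (by linarith)
  simp only [Pi.add_apply] at h
  simp only [realTrapezoidTerm]
  ring_nf at h ⊢
  linarith

lemma hasSum_rpow_sub_rpow {c : ℝ} (hc : c < 0) :
    HasSum (fun n : ℕ ↦ (n + 1 : ℝ) ^ c - (n + 2 : ℝ) ^ c) 1 := by
  have hnn (n : ℕ) : 0 ≤ (n + 1 : ℝ) ^ c - (n + 2 : ℝ) ^ c :=
    sub_nonneg.mpr (Real.rpow_le_rpow_of_nonpos (by positivity) (by linarith) hc.le)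
  rw [hasSum_iff_tendsto_nat_of_nonneg hnn]
  have heq (N : ℕ) : ∑ n ∈ Finset.range N, ((n + 1 : ℝ) ^ c - (n + 2 : ℝ) ^ c)
      = 1 - (N + 1 : ℝ) ^ c := by
    have := Finset.sum_range_sub' (fun n : ℕ ↦ (n + 1 : ℝ) ^ c) N
    simpa [add_assoc, one_add_one_eq_two] using this
  simp_rw [heq]
  have ht := ((tendsto_rpow_neg_atTop (by linarith : 0 < -c)).comp
    tendsto_natCast_atTop_atTop).comp (tendsto_add_atTop_nat 1)
  simpa [Function.comp_def] using ht.const_sub 1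

lemma mul_zr_ge {s : ℝ} (hs : s ∈ Ioo (-1 : ℝ) 1) :
    s ^ 2 * (s - 1) / 8 ≤ s * ((s - 1) * zr s - (s - 1) / 2 - 1) := by
  have h := hasSum_le (fun n ↦ mul_realTrapezoidTerm_le hs n)
    ((hasSum_rpow_sub_rpow (by linarith [hs.1] : -s - 1 < 0)).mul_left (s ^ 2 * (s - 1) / 8))
    ((hasSum_realTrapezoidTerm hs).mul_left s)
  simpa using h

theorem delta1_neg (α : ℝ) (hα0 : 0 < α) (hα1 : α < 1) :
    (2:ℝ) ^ (-α) + 4 * zr α - 4 * zr (α - 1) < 0 := by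
  have hpow : (2 : ℝ) ^ (-α) < 1 := Real.rpow_lt_one_of_one_lt_of_neg (by norm_num) (by linarith)
  have h1 : zr α ≤ 1 / 2 + α / 8 - 1 / (1 - α) := by
    have h := mul_zr_ge (s := α) ⟨by linarith, hα1⟩
    have h' : α * (α - 1) / 8 ≤ (α - 1) * zr α - (α - 1) / 2 - 1 :=
      le_of_mul_le_mul_left (by linarith) hα0
    have hd : 0 < 1 - α := by linarith
    rw [← mul_le_mul_iff_right₀ hd]
    have : (1 - α) * (1 / 2 + α / 8 - 1 / (1 - α)) = (1 - α) * (1 / 2 + α / 8) - 1 := by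
      field_simp
    linarith
  have h2 : 1 / 2 + (α - 1) / 8 - 1 / (2 - α) ≤ zr (α - 1) := by
    have h := mul_zr_ge (s := α - 1) ⟨by linarith, by linarith⟩
    have hneg : 0 < 1 - α := by linarith
    have h' : (α - 1 - 1) * zr (α - 1) - (α - 1 - 1) / 2 - 1 ≤ (α - 1) * (α - 1 - 1) / 8 :=
      le_of_mul_le_mul_left (by linarith) hneg
    have hd : 0 < 2 - α := by linarith
    rw [← mul_le_mul_iff_right₀ hd]
    have : (2 - α) * (1 / 2 + (α - 1) / 8 - 1 / (2 - α))
        = (2 - α) * (1 / 2 + (α - 1) / 8) - 1 := by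
      field_simp
    linarith
  have h3 : 1 / 2 ≤ 1 / (1 - α) - 1 / (2 - α) := by
    have hd1 : 0 < 1 - α := by linarith
    have hd2 : 0 < 2 - α := by linarith
    rw [div_sub_div _ _ hd1.ne' hd2.ne', div_le_div_iff₀ (by norm_num) (by positivity)]
    nlinarith
  linarith
end

section
/- Let 0 < α < 1. Then δ₂ = 3^{−α} − 1 − ζ(α) + 2ζ(α−1) > 0, where ζ is the Riemann zeta function (note ζ(α) and ζ(α−1) are values of the analytic continuation at real arguments in (0,1) and (−1,0) respectively, and are real). -/
open Set Filter Topology MeasureTheory Complex in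
/-- On an interval of length one, the trapezoidal rule for `x ↦ x ^ (-s)` with its error term. -/
lemma integral_quadratic_mul_cpow {s : ℂ} (h0 : s ≠ 0) (h1 : s ≠ 1)
    {a : ℝ} (ha : 0 < a) :
    s * (s + 1) * ∫ x in a..(a + 1), (((x - a) * (a + 1 - x) / 2 : ℝ) : ℂ) * (x : ℂ) ^ (-s - 2)
      = ((a : ℂ) ^ (-s) + ((a + 1 : ℝ) : ℂ) ^ (-s)) / 2
        - (((a + 1 : ℝ) : ℂ) ^ (1 - s) - (a : ℂ) ^ (1 - s)) / (1 - s) := by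
  have hpos : ∀ x ∈ uIcc a (a + 1), 0 < x := fun x hx ↦ by
    rw [uIcc_of_le (by linarith)] at hx
    exact ha.trans_le hx.1
  have h1' : 1 - s ≠ 0 := sub_ne_zero.2 h1.symm
  rw [← intervalIntegral.integral_const_mul,
    intervalIntegral.integral_eq_sub_of_hasDerivAt
      (f := fun x : ℝ ↦ ((x : ℂ) - a) * (a + 1 - x) / 2 * (-s * (x : ℂ) ^ (-s - 1))
        - ((2 * a + 1) / 2 - x) * (x : ℂ) ^ (-s) - (x : ℂ) ^ (1 - s) / (1 - s))]
  · push_cast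
    field_simp
    ring
  · intro x hx
    have hx0 : x ≠ 0 := (hpos x hx).ne'
    have hxc : (x : ℂ) ≠ 0 := ofReal_ne_zero.2 hx0
    have hid : HasDerivAt (fun y : ℝ ↦ (y : ℂ)) 1 x := hasDerivAt_id x |>.ofReal_comp
    have d1 : HasDerivAt (fun y : ℝ ↦ (y : ℂ) ^ (-s - 1)) ((-s - 1) * x ^ (-s - 2)) x := by
      by_cases hs : -s - 1 = 0
      · simpa [hs] using hasDerivAt_const x (1 : ℂ)
      · convert hasDerivAt_ofReal_cpow_const hx0 hs using 3
        ring
    have d2 : HasDerivAt (fun y : ℝ ↦ (y : ℂ) ^ (-s)) (-s * x ^ (-s - 1)) x :=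
      hasDerivAt_ofReal_cpow_const hx0 (neg_ne_zero.2 h0)
    have d3 : HasDerivAt (fun y : ℝ ↦ (y : ℂ) ^ (1 - s)) ((1 - s) * x ^ (-s)) x := by
      convert hasDerivAt_ofReal_cpow_const hx0 h1' using 3
      ring
    convert! (((((hid.sub_const (a : ℂ)).mul (hid.const_sub ((a : ℂ) + 1))).div_const 2).mul
      (d1.const_mul (-s))).sub ((hid.const_sub ((2 * (a : ℂ) + 1) / 2)).mul d2)).sub
      (d3.div_const (1 - s)) using 1
    simp only [Pi.mul_apply]
    push_cast
    field_simp
    ring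
  · refine ContinuousOn.intervalIntegrable fun x hx ↦ ContinuousAt.continuousWithinAt ?_
    have := continuousAt_ofReal_cpow_const x (-s - 2) (Or.inr (hpos x hx).ne')
    fun_prop

/-- The periodic function `{x} (1 - {x}) / 2`. -/
noncomputable def fractParabola (x : ℝ) : ℝ := Int.fract x * (1 - Int.fract x) / 2

lemma fractParabola_nonneg (x : ℝ) : 0 ≤ fractParabola x := by
  have := Int.fract_nonneg x
  have := (Int.fract_lt_one x).le
  exact div_nonneg (mul_nonneg ‹_› (by linarith)) zero_le_two

lemma fractParabola_le (x : ℝ) : fractParabola x ≤ 1 / 8 := by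
  unfold fractParabola
  nlinarith [sq_nonneg (Int.fract x - 1 / 2)]

lemma measurable_fractParabola : Measurable fractParabola := by
  unfold fractParabola
  fun_prop

lemma norm_fractParabola_le (x : ℝ) : ‖(fractParabola x : ℂ)‖ ≤ 1 / 8 := by
  rw [Complex.norm_real, Real.norm_of_nonneg (fractParabola_nonneg x)]
  exact fractParabola_le x

lemma fractParabola_eq {n : ℕ} {x : ℝ} (hx : x ∈ Set.Icc (n : ℝ) (n + 1)) :
    fractParabola x = (x - n) * (n + 1 - x) / 2 := by
  rcases hx.2.eq_or_lt with rfl | h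
  · have : Int.fract ((n : ℝ) + 1) = 0 := by exact_mod_cast Int.fract_natCast (R := ℝ) (n + 1)
    simp [fractParabola, this]
  · have : Int.fract x = x - n :=
      Int.fract_eq_iff.2 ⟨by linarith [hx.1], by linarith, n, by simp⟩
    rw [fractParabola, this]
    ring

open Set Filter Topology MeasureTheory Complex in
lemma integrableOn_fractParabola_mul_cpow {s : ℂ} (hs : -1 < s.re) :
    IntegrableOn (fun x : ℝ ↦ (fractParabola x : ℂ) * (x : ℂ) ^ (-s - 2)) (Ioi 1) :=
  Integrable.bdd_mul (c := 1 / 8)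
    (integrableOn_Ioi_cpow_of_lt (by simp; linarith) one_pos)
    (measurable_ofReal.comp measurable_fractParabola).aestronglyMeasurable
    (Eventually.of_forall norm_fractParabola_le)

open Set Filter Topology MeasureTheory Complex in
lemma integral_fractParabola_mul_cpow {s : ℂ} (hs : 1 < s.re) (N : ℕ) :
    s * (s + 1) * ∫ x in (1 : ℝ)..(N + 1), (fractParabola x : ℂ) * (x : ℂ) ^ (-s - 2)
      = ∑ n ∈ Finset.range N, 1 / (n + 1 : ℂ) ^ s - 1 / 2 + ((N + 1 : ℝ) : ℂ) ^ (-s) / 2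
        - (((N + 1 : ℝ) : ℂ) ^ (1 - s) - 1) / (1 - s) := by
  have h0 : s ≠ 0 := ne_zero_of_one_lt_re hs
  have h1 : s ≠ 1 := by rintro rfl; simp at hs
  have h1' : 1 - s ≠ 0 := sub_ne_zero.2 h1.symm
  have hint : ∀ a b : ℝ, 1 ≤ a → a ≤ b → IntervalIntegrable
      (fun x : ℝ ↦ (fractParabola x : ℂ) * (x : ℂ) ^ (-s - 2)) volume a b := fun a b ha hab ↦
    (intervalIntegrable_iff_integrableOn_Ioc_of_le hab).2
      ((integrableOn_fractParabola_mul_cpow (by linarith)).mono_set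
        (Ioc_subset_Ioi_self.trans (Ioi_subset_Ioi ha)))
  induction N with
  | zero => simp
  | succ N ih =>
    have hN : (0 : ℝ) ≤ N := N.cast_nonneg
    have step := integral_quadratic_mul_cpow h0 h1 (a := N + 1) (by positivity)
    rw [intervalIntegral.integral_congr (g := fun x : ℝ ↦
      (fractParabola x : ℂ) * (x : ℂ) ^ (-s - 2))] at step
    · rw [Nat.cast_succ, ← intervalIntegral.integral_add_adjacent_intervals
        (hint 1 (N + 1) le_rfl (by linarith)) (hint (N + 1) (N + 1 + 1) (by linarith) (by linarith)),
        mul_add, ih, step, Finset.sum_range_succ, cpow_neg, cpow_neg]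
      push_cast
      field_simp
      ring
    · intro x hx
      rw [uIcc_of_le (by linarith)] at hx
      simp only
      rw [fractParabola_eq (n := N + 1) (by exact_mod_cast hx)]
      push_cast
      rfl

open Set Filter Topology MeasureTheory Complex in
lemma tendsto_natCast_add_one_cpow_zero {s : ℂ} (hs : s.re < 0) :
    Tendsto (fun N : ℕ ↦ ((N + 1 : ℝ) : ℂ) ^ s) atTop (𝓝 0) := by
  rw [tendsto_zero_iff_norm_tendsto_zero]
  have h : Tendsto (fun N : ℕ ↦ (N : ℝ) + 1) atTop atTop :=
    tendsto_atTop_add_const_right _ _ tendsto_natCast_atTop_atTop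
  refine ((tendsto_rpow_neg_atTop (neg_pos.2 hs)).comp h).congr fun N ↦ ?_
  rw [norm_cpow_eq_rpow_re_of_pos (by positivity)]
  simp

open Set Filter Topology MeasureTheory Complex in
lemma riemannZeta_eq_integral_of_one_lt_re {s : ℂ} (hs : 1 < s.re) :
    riemannZeta s = 1 / (s - 1) + 1 / 2
      + s * (s + 1) * ∫ x in Ioi (1 : ℝ), (fractParabola x : ℂ) * (x : ℂ) ^ (-s - 2) := by
  have h1 : s ≠ 1 := by rintro rfl; simp at hs
  have h1' : 1 - s ≠ 0 := sub_ne_zero.2 h1.symm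
  have h1'' : s - 1 ≠ 0 := sub_ne_zero.2 h1
  have h : Tendsto (fun N : ℕ ↦ (N : ℝ) + 1) atTop atTop :=
    tendsto_atTop_add_const_right _ _ tendsto_natCast_atTop_atTop
  have hI := (intervalIntegral_tendsto_integral_Ioi 1
    (integrableOn_fractParabola_mul_cpow (s := s) (by linarith)) h).const_mul (s * (s + 1))
  simp only [integral_fractParabola_mul_cpow hs] at hI
  have hsum : Summable fun n : ℕ ↦ 1 / (n + 1 : ℂ) ^ s := by
    simpa using (summable_nat_add_iff 1).2 (summable_one_div_nat_cpow.2 hs)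
  have hz := hsum.hasSum.tendsto_sum_nat
  rw [← zeta_eq_tsum_one_div_nat_add_one_cpow hs] at hz
  have hlim := ((hz.sub_const (1 / 2)).add
    ((tendsto_natCast_add_one_cpow_zero (s := -s) (by simp; linarith)).div_const 2)).sub
    (((tendsto_natCast_add_one_cpow_zero (s := 1 - s) (by simp; linarith)).sub_const 1).div_const
      (1 - s))
  rw [tendsto_nhds_unique hI hlim]
  field_simp
  ring

open Set Filter Topology MeasureTheory Complex in
lemma differentiableAt_integral_fractParabola {s : ℂ} (hs : -1 < s.re) :
    DifferentiableAt ℂ (fun z : ℂ ↦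
      ∫ x in Ioi (1 : ℝ), (fractParabola x : ℂ) * (x : ℂ) ^ (-z - 2)) s := by
  set f : ℝ → ℂ := (Ioi 1).indicator fun x ↦ (fractParabola x : ℂ) with hf
  have hbound : ∀ x, ‖f x‖ ≤ 1 / 8 := fun x ↦
    (norm_indicator_le_norm_self _ _).trans (norm_fractParabola_le x)
  have hmeas : Measurable f :=
    (measurable_ofReal.comp measurable_fractParabola).indicator measurableSet_Ioi
  have hmellin : (fun z : ℂ ↦ ∫ x in Ioi (1 : ℝ), (fractParabola x : ℂ) * (x : ℂ) ^ (-z - 2))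
      = fun z ↦ mellin f (-z - 1) := by
    ext z
    have : ∀ x : ℝ, (x : ℂ) ^ (-z - 1 - 1) • f x = (Ioi (1 : ℝ)).indicator
        (fun x : ℝ ↦ (fractParabola x : ℂ) * (x : ℂ) ^ (-z - 2)) x := fun x ↦ by
      by_cases hx : x ∈ Ioi (1 : ℝ)
      · rw [hf, indicator_of_mem hx, indicator_of_mem hx, smul_eq_mul, mul_comm]
        ring_nf
      · rw [hf, indicator_of_notMem hx, indicator_of_notMem hx, smul_zero]
    simp_rw [mellin, this]
    rw [setIntegral_indicator measurableSet_Ioi,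
      inter_eq_self_of_subset_right (Ioi_subset_Ioi zero_le_one)]
  rw [hmellin]
  have hloc : LocallyIntegrable f := by
    refine (locallyIntegrable_const (1 / 8 : ℝ)).mono hmeas.aestronglyMeasurable
      (Eventually.of_forall fun x ↦ (hbound x).trans (le_abs_self _))
  have hd : DifferentiableAt ℂ (mellin f) (-s - 1) := by
    refine mellin_differentiableAt_of_isBigO_rpow (a := 0) (b := (-s - 1).re - 1)
      (hloc.locallyIntegrableOn _) ?_ (by simp; linarith) ?_ (by linarith)
    · refine Asymptotics.IsBigO.of_bound (1 / 8) (Eventually.of_forall fun x ↦ ?_)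
      simpa using hbound x
    · refine (EventuallyEq.trans_isBigO ?_ (Asymptotics.isBigO_zero _ _))
      filter_upwards [nhdsWithin_le_nhds (Iio_mem_nhds one_pos)] with x hx
      exact indicator_of_notMem (notMem_Ioi.2 (le_of_lt hx)) _
  exact hd.comp (f := fun z : ℂ ↦ -z - 1) s (by fun_prop)

open Set Filter Topology MeasureTheory Complex in
/-- The first Euler-Maclaurin formula for the Riemann zeta function, on `-1 < re s`. -/
lemma riemannZeta_eq_integral {s : ℂ} (hs : -1 < s.re) (h1 : s ≠ 1) :
    riemannZeta s = 1 / (s - 1) + 1 / 2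
      + s * (s + 1) * ∫ x in Ioi (1 : ℝ), (fractParabola x : ℂ) * (x : ℂ) ^ (-s - 2) := by
  have hopen : IsOpen {z : ℂ | -1 < z.re} := isOpen_lt continuous_const continuous_re
  have key : EqOn riemannZeta₁ (fun z ↦ 1 + (z - 1) / 2 + (z - 1) * (z * (z + 1)) *
      ∫ x in Ioi (1 : ℝ), (fractParabola x : ℂ) * (x : ℂ) ^ (-z - 2)) {z : ℂ | -1 < z.re} := by
    refine AnalyticOnNhd.eqOn_of_preconnected_of_eventuallyEq (z₀ := 2)
      (differentiable_riemannZeta₁.differentiableOn.analyticOnNhd hopen)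
      (DifferentiableOn.analyticOnNhd (fun z hz ↦ ?_) hopen)
      (convex_halfSpace_re_gt (-1)).isPreconnected (by simp; norm_num) ?_
    · have := differentiableAt_integral_fractParabola hz
      exact DifferentiableAt.differentiableWithinAt (by fun_prop)
    · filter_upwards [(isOpen_lt continuous_const continuous_re).mem_nhds
        (show (2 : ℂ) ∈ {z : ℂ | 1 < z.re} by simp)] with z hz
      have hz1 : z - 1 ≠ 0 := sub_ne_zero.2 (by rintro rfl; simp at hz)
      have := riemannZeta_eq_integral_of_one_lt_re hz
      rw [riemannZeta_eq_inv_sub_mul (sub_ne_zero.1 hz1)] at this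
      field_simp at this
      linear_combination this / 2
  have h1' : s - 1 ≠ 0 := sub_ne_zero.2 h1
  rw [riemannZeta_eq_inv_sub_mul h1, key hs]
  field_simp

open Set Filter Topology MeasureTheory Complex in
/-- Real form of the first Euler-Maclaurin formula, with bounds for the error term. -/
lemma exists_zr_eq {s : ℝ} (hs : -1 < s) (h1 : s ≠ 1) :
    ∃ J : ℝ, 0 ≤ J ∧ (s + 1) * J ≤ 1 / 8 ∧ zr s = 1 / (s - 1) + 1 / 2 + s * ((s + 1) * J) := by
  have hrpow : IntegrableOn (fun x : ℝ ↦ x ^ (-s - 2)) (Ioi 1) :=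
    integrableOn_Ioi_rpow_of_lt (by linarith) one_pos
  refine ⟨∫ x in Ioi (1 : ℝ), fractParabola x * x ^ (-s - 2), ?_, ?_, ?_⟩
  · refine setIntegral_nonneg measurableSet_Ioi fun x hx ↦ ?_
    exact mul_nonneg (fractParabola_nonneg x) (Real.rpow_nonneg (zero_le_one.trans (le_of_lt hx)) _)
  · have hle : ∫ x in Ioi (1 : ℝ), fractParabola x * x ^ (-s - 2)
        ≤ ∫ x in Ioi (1 : ℝ), 1 / 8 * x ^ (-s - 2) := by
      refine setIntegral_mono_on ?_ (hrpow.const_mul _) measurableSet_Ioi fun x hx ↦ ?_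
      · refine Integrable.bdd_mul (c := 1 / 8) hrpow
          measurable_fractParabola.aestronglyMeasurable (Eventually.of_forall fun x ↦ ?_)
        rw [Real.norm_of_nonneg (fractParabola_nonneg x)]
        exact fractParabola_le x
      · exact mul_le_mul_of_nonneg_right (fractParabola_le x)
          (Real.rpow_nonneg (zero_le_one.trans (le_of_lt hx)) _)
    rw [integral_const_mul, integral_Ioi_rpow_of_lt (by linarith) one_pos, Real.one_rpow] at hle
    have hpos : 0 < s + 1 := by linarith
    calc _ ≤ (s + 1) * (1 / 8 * (-1 / (-s - 2 + 1))) := mul_le_mul_of_nonneg_left hle hpos.le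
      _ = 1 / 8 := by
        rw [show -s - 2 + 1 = -(s + 1) by ring]
        field_simp
  · have hcast : ∫ x in Ioi (1 : ℝ), (fractParabola x : ℂ) * (x : ℂ) ^ (-(s : ℂ) - 2)
        = ((∫ x in Ioi (1 : ℝ), fractParabola x * x ^ (-s - 2) : ℝ) : ℂ) := by
      rw [← integral_complex_ofReal]
      refine setIntegral_congr_fun measurableSet_Ioi fun x hx ↦ ?_
      rw [ofReal_mul, ofReal_cpow (zero_le_one.trans (le_of_lt hx))]
      push_cast
      rfl
    have h := riemannZeta_eq_integral (s := (s : ℂ)) (by simpa using hs) (by exact_mod_cast h1)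
    rw [hcast] at h
    rw [zr, h, ← ofReal_re (1 / (s - 1) + 1 / 2 + s * ((s + 1) * _))]
    congr 1
    push_cast
    ring

lemma one_sub_le_three_rpow_neg (α : ℝ) : 1 - 1.36 * |α| ≤ (3 : ℝ) ^ (-α) := by
  have hlog : Real.log 3 ≤ 1.36 := by
    rw [Real.log_le_iff_le_exp (by norm_num)]
    have := Real.quadratic_le_exp_of_nonneg (x := 0.68) (by norm_num)
    calc (3 : ℝ) ≤ (1 + 0.68 + 0.68 ^ 2 / 2) ^ 2 := by norm_num
      _ ≤ Real.exp 0.68 ^ 2 := by gcongr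
      _ = Real.exp 1.36 := by rw [← Real.exp_nat_mul]; norm_num
  have h0 : 0 ≤ Real.log 3 := Real.log_nonneg (by norm_num)
  rw [Real.rpow_def_of_pos (by norm_num)]
  have := Real.add_one_le_exp (Real.log 3 * -α)
  nlinarith [le_abs_self α, abs_nonneg α]

theorem delta2_pos (α : ℝ) (hα0 : 0 < α) (hα1 : α < 1) :
    (3:ℝ) ^ (-α) - 1 - zr α + 2 * zr (α - 1) > 0 := by
  obtain ⟨J, -, hJ, hz⟩ := exists_zr_eq (s := α) (by linarith) hα1.ne
  obtain ⟨K, -, hK, hz'⟩ := exists_zr_eq (s := α - 1) (by linarith) (by linarith)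
  have h3 := one_sub_le_three_rpow_neg α
  rw [abs_of_pos hα0] at h3
  rw [hz, hz']
  have e1 : α * ((α + 1) * J) ≤ α * (1 / 8) := mul_le_mul_of_nonneg_left hJ hα0.le
  have e2 : (α - 1) * (1 / 8) ≤ (α - 1) * ((α - 1 + 1) * K) :=
    mul_le_mul_of_nonpos_left hK (by linarith)
  have hpos : 0 < (1 - α) * (2 - α) := mul_pos (by linarith) (by linarith)
  have hfrac : -(1 / (α - 1)) + 2 * (1 / (α - 1 - 1)) = α / ((1 - α) * (2 - α)) := by
    have h1 : α - 1 ≠ 0 := by linarith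
    have h2 : α - 1 - 1 ≠ 0 := by linarith
    rw [eq_div_iff hpos.ne']
    field_simp
    ring
  have hlow : α * (1 / 2 + 3 / 4 * α) ≤ α / ((1 - α) * (2 - α)) := by
    rw [le_div_iff₀ hpos]
    have : (1 / 2 + 3 / 4 * α) * ((1 - α) * (2 - α)) ≤ 1 := by
      nlinarith [mul_pos hα0 hα0, mul_nonneg (mul_pos hα0 hα0).le (sub_nonneg.2 hα1.le)]
    nlinarith
  nlinarith [sq_nonneg (α - 0.49)]
end

section
/- (Stability of the numerical scheme, D > 0.) Let 0 < α < 1, let D > 0, let 0 < h ≤ 1, let λ₀ > 0 and A > 0, and let n ≥ 2 be an integer. Suppose that for each m with 2 ≤ m ≤ n there are positive weights λ_{m,1}, …, λ_{m,m} with Σ_{k=1}^{m} λ_{m,k} = λ₀. Suppose (e_m)_{m=0}^{n} is a real sequence with e₀ = 0, |e₁| ≤ A h^{2−α}, and for each 2 ≤ m ≤ n there is a real number A_m with |A_m| ≤ A such that e_m = (1/(λ₀ + D h^α)) Σ_{k=1}^{m} λ_{m,k} e_{m−k} + A_m h². Then for every constant C > max{ A, A(λ₀ + D)/D } one has |e_m|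 < C h^{2−α} for all 1 ≤ m ≤ n. -/
theorem stability_positive_D
    (α D h lam0 A : ℝ) (hα0 : 0 < α) (hα1 : α < 1) (hD : 0 < D)
    (hh0 : 0 < h) (hh1 : h ≤ 1) (hlam0 : 0 < lam0) (hA : 0 < A)
    (n : ℕ) (hn : 2 ≤ n) (lam : ℕ → ℕ → ℝ)
    (hpos : ∀ m, 2 ≤ m → m ≤ n → ∀ k, 1 ≤ k → k ≤ m → 0 < lam m k)
    (hsum : ∀ m, 2 ≤ m → m ≤ n → ∑ k ∈ Finset.Icc 1 m, lam m k = lam0)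
    (e : ℕ → ℝ) (he0 : e 0 = 0) (he1 : |e 1| ≤ A * h ^ (2 - α))
    (hrec : ∀ m, 2 ≤ m → m ≤ n → ∃ Am : ℝ, |Am| ≤ A ∧
      e m = (1 / (lam0 + D * h ^ α)) * (∑ k ∈ Finset.Icc 1 m, lam m k * e (m - k))
              + Am * h ^ 2) :
    ∀ C : ℝ, max A (A * (lam0 + D) / D) < C →
      ∀ m, 1 ≤ m → m ≤ n → |e m| < C * h ^ (2 - α) := by
  intro C hC m
  obtain ⟨hCA, hCD⟩ := max_lt_iff.1 hC
  rw [div_lt_iff₀ hD] at hCD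
  have hp : 0 < h ^ α := Real.rpow_pos_of_pos hh0 α
  have hp1 : h ^ α ≤ 1 := Real.rpow_le_one hh0.le hh1 hα0.le
  have hq : 0 < h ^ (2 - α) := Real.rpow_pos_of_pos hh0 _
  have hpq : h ^ 2 = h ^ α * h ^ (2 - α) := by
    rw [← Real.rpow_add hh0, add_sub_cancel, Real.rpow_two]
  have hden : 0 < lam0 + D * h ^ α := by positivity
  have hCpos : 0 < C := hA.trans hCA
  induction m using Nat.strong_induction_on with
  | _ m ih =>
    intro hm1 hmn
    rcases hm1.eq_or_lt with rfl | hm2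
    · exact he1.trans_lt (mul_lt_mul_of_pos_right hCA hq)
    obtain ⟨Am, hAm, hem⟩ := hrec m hm2 hmn
    have hprev : ∀ j, j < m → |e j| ≤ C * h ^ (2 - α) := by
      intro j hj
      rcases Nat.eq_zero_or_pos j with rfl | hj0
      · rw [he0, abs_zero]
        positivity
      · exact (ih j hj hj0 (hj.le.trans hmn)).le
    have hS : |∑ k ∈ Finset.Icc 1 m, lam m k * e (m - k)| ≤ lam0 * (C * h ^ (2 - α)) := by
      rw [← hsum m hm2 hmn, Finset.sum_mul]
      refine (Finset.abs_sum_le_sum_abs _ _).trans (Finset.sum_le_sum fun k hk => ?_)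
      obtain ⟨hk1, hkm⟩ := Finset.mem_Icc.1 hk
      have hl := hpos m hm2 hmn k hk1 hkm
      rw [abs_mul, abs_of_pos hl]
      exact mul_le_mul_of_nonneg_left (hprev _ (by omega)) hl.le
    have hbound : |e m| ≤ 1 / (lam0 + D * h ^ α) * (lam0 * (C * h ^ (2 - α))) + A * h ^ 2 := by
      rw [hem]
      refine (abs_add_le _ _).trans ?_
      rw [abs_mul, abs_mul, abs_of_pos (one_div_pos.2 hden), abs_of_pos (pow_pos hh0 2)]
      gcongr
    refine hbound.trans_lt ?_
    have hkey : A * (lam0 + D * h ^ α) < C * D := by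
      refine lt_of_le_of_lt ?_ hCD
      gcongr
      exact mul_le_of_le_one_right hD.le hp1
    have hscaled := mul_lt_mul_of_pos_right hkey (mul_pos hp hq)
    rw [hpq, one_div_mul_eq_div, ← lt_sub_iff_add_lt, div_lt_iff₀ hden]
    linarith
end

section
/- (Order 2−α approximation with weights of power −α.) Let 0 < α < 1, x > 0, and let y be smooth (C^∞) on [0, x]. Define W_n[α] = Σ_{k=1}^{n−1} k^{−α} − n^{1−α}/(1−α) − ζ(α) and the weights σ₀ = 1 − 2ζ(α), σ₁ = 2^{−α} + 2ζ(α), σ_k = (k+1)^{−α} − (k−1)^{−α} for 2 ≤ k ≤ n−2, σ_{n−1} = −(n−2)^{−α} − 2W_n[α], σ_n = −(n−1)^{−α} + 2W_n[α]. Then there exists C > 0 (independent of n) such that for all integers n ≥ 4, with h = x/n, | (1/(2Γ(1−α)h^α)) Σ_{k=0}^{n} σ_k y(x−kh) − D^α y(x) | ≤ C h^{2−α}. -/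
/-- The Caputo derivative of order `α` of `y` at `x`. -/
noncomputable def caputo (α : ℝ) (y : ℝ → ℝ) (x : ℝ) : ℝ :=
  (1 / Real.Gamma (1 - α)) * ∫ t in (0:ℝ)..x, deriv y t / (x - t) ^ α

/-- `W_n[α] = Σ_{k=1}^{n−1} k^{−α} − n^{1−α}/(1−α) − ζ(α)`. -/
noncomputable def W (n : ℕ) (α : ℝ) : ℝ :=
  (∑ k ∈ Finset.Icc 1 (n - 1), (k:ℝ) ^ (-α)) - (n:ℝ) ^ (1 - α) / (1 - α) - zr α

section

open Set Filter Topology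

lemma hasDerivAt_ofReal_cpow_const_of_pos {u : ℝ} (hu : 0 < u) (c : ℂ) :
    HasDerivAt (fun v : ℝ ↦ (v : ℂ) ^ c) (c * (u : ℂ) ^ (c - 1)) u := by
  have h := (hasDerivAt_id (u : ℂ)).cpow_const (c := c) (Or.inl (by simpa using hu))
  simpa using h.comp_ofReal

lemma norm_cpow_neg_sub_le {a u : ℝ} (ha : 0 < a) (hu : u ∈ Icc a (a + 1)) {s : ℂ}
    (hs : 0 < s.re) :
    ‖(u : ℂ) ^ (-s) - (a : ℂ) ^ (-s)‖ ≤ ‖s‖ * a ^ (-s.re - 1) := by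
  have key := norm_image_sub_le_of_norm_deriv_le_segment' (a := a) (b := a + 1)
    (f := fun v : ℝ ↦ (v : ℂ) ^ (-s)) (f' := fun v : ℝ ↦ -s * (v : ℂ) ^ (-s - 1))
    (C := ‖s‖ * a ^ (-s.re - 1))
    (fun v hv ↦ (hasDerivAt_ofReal_cpow_const_of_pos (ha.trans_le hv.1) _).hasDerivWithinAt)
    (fun v hv ↦ by
      rw [norm_mul, norm_neg, Complex.norm_cpow_eq_rpow_re_of_pos (ha.trans_le hv.1)]
      simp only [Complex.sub_re, Complex.neg_re, Complex.one_re]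
      exact mul_le_mul_of_nonneg_left
        (Real.rpow_le_rpow_of_nonpos ha hv.1 (by linarith)) (norm_nonneg _)) u hu
  refine key.trans (mul_le_of_le_one_right (by positivity) (by linarith [hu.2]))

/-- `(s - 1)` times the difference between `(n + 1) ^ (-s)` and the integral of `u ^ (-s)` over
`[n + 1, n + 2]`. -/
noncomputable def zetaTerm (n : ℕ) (s : ℂ) : ℂ :=
  (s - 1) * ((n + 1 : ℝ) : ℂ) ^ (-s)
    + (((n + 2 : ℝ) : ℂ) ^ (1 - s) - ((n + 1 : ℝ) : ℂ) ^ (1 - s))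

lemma norm_zetaTerm_le (n : ℕ) {s : ℂ} (hs : 0 < s.re) :
    ‖zetaTerm n s‖ ≤ ‖s - 1‖ * ‖s‖ * (n + 1 : ℝ) ^ (-s.re - 1) := by
  have ha : (0 : ℝ) < n + 1 := by positivity
  set a : ℝ := n + 1 with ha_def
  have key := norm_image_sub_le_of_norm_deriv_le_segment' (a := a) (b := a + 1)
    (f := fun v : ℝ ↦ (v : ℂ) ^ (1 - s) + (s - 1) * (a : ℂ) ^ (-s) * (v : ℂ))
    (f' := fun v : ℝ ↦ (1 - s) * ((v : ℂ) ^ (-s) - (a : ℂ) ^ (-s)))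
    (C := ‖s - 1‖ * ‖s‖ * a ^ (-s.re - 1))
    (fun v hv ↦ by
      have h1 := hasDerivAt_ofReal_cpow_const_of_pos (ha.trans_le hv.1) (1 - s)
      have h2 := ((hasDerivAt_id (v : ℂ)).comp_ofReal).const_mul ((s - 1) * (a : ℂ) ^ (-s))
      refine ((h1.add h2).congr_deriv ?_).hasDerivWithinAt
      rw [show 1 - s - 1 = -s by ring]
      ring)
    (fun v hv ↦ by
      rw [norm_mul, mul_assoc, norm_sub_rev 1 s]
      exact mul_le_mul_of_nonneg_left
        (norm_cpow_neg_sub_le ha (Ico_subset_Icc_self hv) hs) (norm_nonneg _))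
    (a + 1) ⟨by linarith, le_rfl⟩
  have e : zetaTerm n s =
      (((a + 1 : ℝ) : ℂ) ^ (1 - s) + (s - 1) * (a : ℂ) ^ (-s) * ((a + 1 : ℝ) : ℂ))
      - ((a : ℂ) ^ (1 - s) + (s - 1) * (a : ℂ) ^ (-s) * (a : ℂ)) := by
    rw [zetaTerm, show ((n : ℝ) + 2) = a + 1 by rw [ha_def]; ring, ← ha_def]
    push_cast
    ring
  rw [e]
  simpa using key

lemma differentiable_zetaTerm (n : ℕ) : Differentiable ℂ (zetaTerm n) := by
  have h1 : ((n + 1 : ℝ) : ℂ) ≠ 0 := by exact_mod_cast (by positivity : (n + 1 : ℝ) ≠ 0)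
  have h2 : ((n + 2 : ℝ) : ℂ) ≠ 0 := by exact_mod_cast (by positivity : (n + 2 : ℝ) ≠ 0)
  unfold zetaTerm
  intro s
  refine DifferentiableAt.add (DifferentiableAt.mul (by fun_prop) ?_) (DifferentiableAt.sub ?_ ?_)
  · exact DifferentiableAt.const_cpow (by fun_prop) (Or.inl h1)
  · exact DifferentiableAt.const_cpow (by fun_prop) (Or.inl h2)
  · exact DifferentiableAt.const_cpow (by fun_prop) (Or.inl h1)

lemma sum_range_zetaTerm (N : ℕ) (s : ℂ) :
    ∑ n ∈ Finset.range N, zetaTerm n s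
      = (s - 1) * ∑ n ∈ Finset.range N, ((n + 1 : ℝ) : ℂ) ^ (-s)
        + (((N + 1 : ℝ) : ℂ) ^ (1 - s) - 1) := by
  induction N with
  | zero => simp
  | succ N ih =>
    rw [Finset.sum_range_succ, Finset.sum_range_succ, ih, zetaTerm]
    push_cast
    rw [show (N : ℂ) + 1 + 1 = N + 2 by ring]
    ring

lemma summable_nat_add_one_rpow {p : ℝ} (hp : p < -1) :
    Summable (fun n : ℕ ↦ (n + 1 : ℝ) ^ p) := by
  have := (summable_nat_add_iff 1).mpr (Real.summable_nat_rpow.mpr hp)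
  exact_mod_cast this

lemma summable_zetaTerm {s : ℂ} (hs : 0 < s.re) : Summable (fun n ↦ zetaTerm n s) :=
  Summable.of_norm_bounded ((summable_nat_add_one_rpow (by linarith)).mul_left _)
    (fun n ↦ norm_zetaTerm_le n hs)

lemma one_add_tsum_zetaTerm_of_one_lt {s : ℂ} (hs : 1 < s.re) :
    1 + ∑' n, zetaTerm n s = (s - 1) * riemannZeta s := by
  have h1 := (summable_zetaTerm (s := s) (by linarith)).hasSum.tendsto_sum_nat
  simp_rw [sum_range_zetaTerm] at h1
  have hsum : Summable (fun n : ℕ ↦ ((n + 1 : ℝ) : ℂ) ^ (-s)) := by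
    have := (summable_nat_add_iff 1).mpr (Complex.summable_one_div_nat_cpow.mpr hs)
    refine this.congr fun n ↦ ?_
    push_cast
    rw [Complex.cpow_neg, one_div]
  have hz : riemannZeta s = ∑' n : ℕ, ((n + 1 : ℝ) : ℂ) ^ (-s) := by
    rw [zeta_eq_tsum_one_div_nat_add_one_cpow hs]
    refine tsum_congr fun n ↦ ?_
    push_cast
    rw [Complex.cpow_neg, one_div]
  have h3 : Tendsto (fun N : ℕ ↦ ((N + 1 : ℝ) : ℂ) ^ (1 - s)) atTop (𝓝 0) := by
    rw [tendsto_zero_iff_norm_tendsto_zero]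
    have : Tendsto (fun N : ℕ ↦ (N + 1 : ℝ) ^ (-(s.re - 1))) atTop (𝓝 0) :=
      (tendsto_rpow_neg_atTop (by linarith)).comp
        (tendsto_atTop_add_const_right _ _ tendsto_natCast_atTop_atTop)
    refine this.congr fun N ↦ ?_
    rw [Complex.norm_cpow_eq_rpow_re_of_pos (by positivity)]
    simp
  have h4 := ((hsum.hasSum.tendsto_sum_nat).const_mul (s - 1)).add (h3.sub_const 1)
  have := tendsto_nhds_unique h1 h4
  rw [this, hz]
  ring

lemma one_add_tsum_zetaTerm {s : ℂ} (hs : 0 < s.re) (hs1 : s ≠ 1) :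
    1 + ∑' n, zetaTerm n s = (s - 1) * riemannZeta s := by
  set U : Set ℂ := {w | s.re / 2 < w.re} ∩ Metric.ball 0 (‖s‖ + 4) with hU
  have hUo : IsOpen U :=
    (isOpen_lt continuous_const Complex.continuous_re).inter Metric.isOpen_ball
  have hUc : Convex ℝ U := (convex_halfSpace_re_gt _).inter (convex_ball _ _)
  have hsU : s ∈ U := ⟨by simp only [mem_ofPred_eq]; linarith, by simp⟩
  have hdiff : DifferentiableOn ℂ (fun w ↦ 1 + ∑' n, zetaTerm n w) U := by
    refine (differentiableOn_const _).add ?_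
    refine Complex.differentiableOn_tsum_of_summable_norm
      (u := fun n : ℕ ↦ ((‖s‖ + 5) * (‖s‖ + 4)) * (n + 1 : ℝ) ^ (-(s.re / 2) - 1))
      ((summable_nat_add_one_rpow (by linarith)).mul_left _)
      (fun n ↦ (differentiable_zetaTerm n).differentiableOn) hUo fun n w hw ↦ ?_
    have hw1 : s.re / 2 < w.re := hw.1
    have hw2 : ‖w‖ < ‖s‖ + 4 := by simpa using hw.2
    refine (norm_zetaTerm_le n (by linarith)).trans ?_
    have : ‖w - 1‖ ≤ ‖s‖ + 5 := by
      have := norm_sub_le w 1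
      simp only [norm_one] at this
      linarith
    gcongr
    simp
  have hE : ∀ w : ℂ, w ≠ 1 →
      DirichletCharacter.LFunctionTrivChar₁ 1 w = (w - 1) * riemannZeta w := fun w hw ↦ by
    rw [DirichletCharacter.LFunctionTrivChar₁, Function.update_of_ne hw,
      DirichletCharacter.LFunctionTrivChar, DirichletCharacter.LFunction_modOne_eq]
  rw [← hE s hs1]
  set p : ℂ := ((‖s‖ / 2 + 2 : ℝ) : ℂ) with hp
  have hp_re : p.re = ‖s‖ / 2 + 2 := Complex.ofReal_re _
  have hpU : p ∈ U := by
    have := Complex.re_le_norm s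
    refine ⟨by simp only [mem_ofPred_eq, hp_re]; linarith, ?_⟩
    rw [mem_ball_zero_iff, hp, Complex.norm_real, Real.norm_of_nonneg (by positivity)]
    linarith [norm_nonneg s]
  refine (hdiff.analyticOnNhd hUo).eqOn_of_preconnected_of_eventuallyEq
    ((DirichletCharacter.differentiable_LFunctionTrivChar₁ 1).differentiableOn.analyticOnNhd hUo)
    hUc.isPreconnected hpU ?_ hsU
  have hnhds : {w : ℂ | 1 < w.re} ∈ 𝓝 p :=
    (isOpen_lt continuous_const Complex.continuous_re).mem_nhds
      (by simp only [mem_ofPred_eq, hp_re]; linarith [norm_nonneg s])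
  filter_upwards [hnhds] with w hw
  have hw1 : 1 < w.re := hw
  rw [hE w (by rintro rfl; simp at hw1), one_add_tsum_zetaTerm_of_one_lt hw1]

lemma tendsto_W {α : ℝ} (hα0 : 0 < α) (hα1 : α < 1) :
    Tendsto (fun n ↦ W n α) atTop (𝓝 0) := by
  rw [← tendsto_add_atTop_iff_nat 1]
  have hs : 0 < ((α : ℝ) : ℂ).re := by simpa using hα0
  have hs1 : (α : ℂ) ≠ 1 := by exact_mod_cast hα1.ne
  have h := (summable_zetaTerm hs).hasSum.tendsto_sum_nat
  rw [eq_sub_of_add_eq' (one_add_tsum_zetaTerm hs hs1)] at h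
  have h2 := (Complex.continuous_re.tendsto _).comp h
  have hlim : (((α : ℂ) - 1) * riemannZeta α - 1).re = (α - 1) * zr α - 1 := by
    rw [zr, show (α : ℂ) - 1 = ((α - 1 : ℝ) : ℂ) by push_cast; ring, Complex.sub_re,
      Complex.re_ofReal_mul, Complex.one_re]
  rw [hlim] at h2
  have h3 := ((h2.add_const 1).div_const (α - 1)).sub_const (zr α)
  have hne : α - 1 ≠ 0 := by linarith
  rw [show ((α - 1) * zr α - 1 + 1) / (α - 1) - zr α = 0 by field_simp; ring] at h3
  refine h3.congr fun N ↦ ?_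
  have hre : (∑ n ∈ Finset.range N, zetaTerm n (α : ℂ)).re
      = (α - 1) * ∑ n ∈ Finset.range N, (n + 1 : ℝ) ^ (-α) + ((N + 1 : ℝ) ^ (1 - α) - 1) := by
    rw [sum_range_zetaTerm, ← Complex.ofReal_re
      ((α - 1) * ∑ n ∈ Finset.range N, (n + 1 : ℝ) ^ (-α) + ((N + 1 : ℝ) ^ (1 - α) - 1))]
    congr 1
    push_cast [Complex.ofReal_cpow (show (0 : ℝ) ≤ N + 1 by positivity)]
    congr 2
    refine Finset.sum_congr rfl fun n _ ↦ ?_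
    rw [Complex.ofReal_cpow (by positivity)]
    push_cast
    rfl
  have hsum : ∑ k ∈ Finset.Icc 1 N, (k : ℝ) ^ (-α)
      = ∑ n ∈ Finset.range N, (n + 1 : ℝ) ^ (-α) := by
    clear * -
    induction N with
    | zero => simp
    | succ N ih =>
      rw [Finset.sum_Icc_succ_top (by omega), Finset.sum_range_succ, ih]
      push_cast
      rfl
  simp only [Function.comp_apply, hre, W, Nat.add_sub_cancel, hsum]
  have hne' : 1 - α ≠ 0 := by linarith
  push_cast
  rw [show α - 1 = -(1 - α) by ring]
  field_simp
  ring

lemma W_succ {α : ℝ} (hα0 : 0 < α) (hα1 : α < 1) (n : ℕ) :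
    W (n + 1) α
      = W n α + (n : ℝ) ^ (-α) - ((n + 1 : ℝ) ^ (1 - α) - (n : ℝ) ^ (1 - α)) / (1 - α) := by
  rcases n with _ | n
  · simp [W, Real.zero_rpow (neg_ne_zero.mpr hα0.ne'), Real.zero_rpow (sub_pos.mpr hα1).ne']
    ring
  · simp only [W, Nat.add_sub_cancel]
    rw [Finset.sum_Icc_succ_top (by omega)]
    push_cast
    ring

lemma W_zero {α : ℝ} (hα1 : α < 1) : W 0 α = -zr α := by
  simp [W, Real.zero_rpow (sub_pos.mpr hα1).ne']

lemma exists_rpow_sub_rpow_eq {a b : ℝ} (ha : 0 < a) (hab : a < b) (p : ℝ) :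
    ∃ c ∈ Ioo a b, b ^ p - a ^ p = (b - a) * (p * c ^ (p - 1)) := by
  obtain ⟨c, hc, h⟩ := exists_hasDerivAt_eq_slope (fun v : ℝ ↦ v ^ p)
    (fun v ↦ p * v ^ (p - 1)) hab
    (fun v hv ↦ (Real.continuousAt_rpow_const _ _
      (Or.inl (ha.trans_le hv.1).ne')).continuousWithinAt)
    (fun v hv ↦ Real.hasDerivAt_rpow_const (Or.inl (ha.trans hv.1).ne'))
  refine ⟨c, hc, ?_⟩
  have : b - a ≠ 0 := by linarith
  rw [h]
  field_simp

lemma trapezoid_rpow_neg_bounds {a α : ℝ} (ha : 0 < a) (hα0 : 0 < α) (hα1 : α < 1) :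
    0 ≤ (a ^ (-α) + (a + 1) ^ (-α)) / 2 - ((a + 1) ^ (1 - α) - a ^ (1 - α)) / (1 - α) ∧
    (a ^ (-α) + (a + 1) ^ (-α)) / 2 - ((a + 1) ^ (1 - α) - a ^ (1 - α)) / (1 - α)
      ≤ α / 2 * (a ^ (-α - 1) - (a + 1) ^ (-α - 1)) := by
  have h1α : 1 - α ≠ 0 := by linarith
  have hder : ∀ v : ℝ, 0 < v → HasDerivAt
      (fun v : ℝ ↦ (v - a) * (a ^ (-α) + v ^ (-α)) / 2 - (v ^ (1 - α) - a ^ (1 - α)) / (1 - α))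
      ((a ^ (-α) - v ^ (-α)) / 2 - α * (v - a) * v ^ (-α - 1) / 2) v := fun v hv ↦ by
    have e1 := Real.hasDerivAt_rpow_const (x := v) (p := -α) (Or.inl hv.ne')
    have e2 := Real.hasDerivAt_rpow_const (x := v) (p := 1 - α) (Or.inl hv.ne')
    refine (((((hasDerivAt_id v).sub_const a).mul (e1.const_add (a ^ (-α)))).div_const 2).sub
      ((e2.sub_const (a ^ (1 - α))).div_const (1 - α))).congr_deriv ?_
    rw [show 1 - α - 1 = -α by ring]
    simp only [id]
    field_simp
    ring
  obtain ⟨c, hc, h⟩ := exists_hasDerivAt_eq_slope _ _ (lt_add_one a)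
    (fun v hv ↦ (hder v (ha.trans_le hv.1)).continuousAt.continuousWithinAt)
    (fun v hv ↦ hder v (ha.trans hv.1))
  have hc0 : 0 < c := ha.trans hc.1
  obtain ⟨d, hd, h'⟩ := exists_rpow_sub_rpow_eq ha hc.1 (-α)
  have htrap : (a ^ (-α) + (a + 1) ^ (-α)) / 2 - ((a + 1) ^ (1 - α) - a ^ (1 - α)) / (1 - α)
      = α * (c - a) / 2 * (d ^ (-α - 1) - c ^ (-α - 1)) := by
    have : a ^ (-α) - c ^ (-α) = (c - a) * (α * d ^ (-α - 1)) := by linarith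
    rw [this] at h
    simp only [sub_self, zero_mul, zero_div, add_sub_cancel_left, one_mul, sub_zero,
      div_one] at h
    rw [← h]
    ring
  have m1 : c ^ (-α - 1) ≤ d ^ (-α - 1) :=
    Real.rpow_le_rpow_of_nonpos (ha.trans hd.1) hd.2.le (by linarith)
  have m2 : d ^ (-α - 1) ≤ a ^ (-α - 1) :=
    Real.rpow_le_rpow_of_nonpos ha hd.1.le (by linarith)
  have m3 : (a + 1) ^ (-α - 1) ≤ c ^ (-α - 1) :=
    Real.rpow_le_rpow_of_nonpos hc0 hc.2.le (by linarith)
  have hca : 0 ≤ c - a := by linarith [hc.1]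
  have hca1 : c - a ≤ 1 := by linarith [hc.2]
  rw [htrap]
  refine ⟨mul_nonneg (by positivity) (by linarith), ?_⟩
  refine mul_le_mul ?_ (by linarith) (by linarith) (by positivity)
  nlinarith

lemma abs_W_add_half_le {α : ℝ} (hα0 : 0 < α) (hα1 : α < 1) {n : ℕ} (hn : 1 ≤ n) :
    |W n α + (n : ℝ) ^ (-α) / 2| ≤ α / 2 * (n : ℝ) ^ (-α - 1) := by
  set V : ℕ → ℝ := fun m ↦ W m α + (m : ℝ) ^ (-α) / 2 with hV
  have hstep : ∀ m : ℕ, n ≤ m → 0 ≤ V m - V n ∧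
      V m - V n ≤ α / 2 * ((n : ℝ) ^ (-α - 1) - (m : ℝ) ^ (-α - 1)) := by
    intro m hm
    induction m, hm using Nat.le_induction with
    | base => simp
    | succ m hm ih =>
      have hm0 : (0 : ℝ) < m := by exact_mod_cast (hn.trans hm)
      have hb := trapezoid_rpow_neg_bounds hm0 hα0 hα1
      have he : V (m + 1) = V m + ((m : ℝ) ^ (-α) + (m + 1 : ℝ) ^ (-α)) / 2
          - ((m + 1 : ℝ) ^ (1 - α) - (m : ℝ) ^ (1 - α)) / (1 - α) := by
        simp only [hV, W_succ hα0 hα1]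
        push_cast
        ring
      rw [he]
      push_cast
      constructor
      · linarith [ih.1, hb.1]
      · linarith [ih.2, hb.2]
  have hlim : Tendsto V atTop (𝓝 0) := by
    have := ((tendsto_rpow_neg_atTop hα0).comp tendsto_natCast_atTop_atTop).div_const 2
    simpa using (tendsto_W hα0 hα1).add this
  have hlow : V n ≤ 0 := by
    refine ge_of_tendsto hlim ?_
    filter_upwards [eventually_ge_atTop n] with m hm
    linarith [(hstep m hm).1]
  have hup : 0 ≤ V n + α / 2 * (n : ℝ) ^ (-α - 1) := by
    refine le_of_tendsto hlim ?_
    filter_upwards [eventually_ge_atTop n] with m hm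
    have : 0 ≤ α / 2 * (m : ℝ) ^ (-α - 1) := by positivity
    linarith [(hstep m hm).2]
  change |V n| ≤ _
  rw [abs_le]
  constructor
  · linarith
  · have : 0 ≤ α / 2 * (n : ℝ) ^ (-α - 1) := by positivity
    linarith

lemma abs_W_le_one {α : ℝ} (hα0 : 0 < α) (hα1 : α < 1) {n : ℕ} (hn : 1 ≤ n) :
    |W n α| ≤ 1 := by
  have hn' : (1 : ℝ) ≤ n := by exact_mod_cast hn
  have h1 := abs_W_add_half_le hα0 hα1 hn
  have h2 : (n : ℝ) ^ (-α) ≤ 1 := Real.rpow_le_one_of_one_le_of_nonpos hn' (by linarith)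
  have h3 : (n : ℝ) ^ (-α - 1) ≤ 1 := Real.rpow_le_one_of_one_le_of_nonpos hn' (by linarith)
  have h4 : 0 ≤ (n : ℝ) ^ (-α) := by positivity
  have h5 : 0 ≤ (n : ℝ) ^ (-α - 1) := by positivity
  rw [abs_le] at h1 ⊢
  constructor <;> nlinarith [h1.1, h1.2]

open MeasureTheory intervalIntegral

/-- On `[k, k + 1]`, the antiderivative of `v ^ (-α)` adapted to the quadrature remainder. -/
noncomputable def cellKernel (α : ℝ) (k : ℕ) (v : ℝ) : ℝ :=
  (v ^ (1 - α) - (k : ℝ) ^ (1 - α)) / (1 - α) - W k α - (k : ℝ) ^ (-α)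

lemma continuous_cellKernel {α : ℝ} (hα1 : α < 1) (k : ℕ) : Continuous (cellKernel α k) := by
  unfold cellKernel
  have : Continuous fun v : ℝ ↦ v ^ (1 - α) := Real.continuous_rpow_const (by linarith)
  fun_prop

lemma integral_cell {α : ℝ} (hα0 : 0 < α) (hα1 : α < 1) {G G' : ℝ → ℝ}
    (hG : ∀ v, HasDerivAt G (G' v) v) (hG' : Continuous G') (k : ℕ) :
    ∫ v in (k : ℝ)..(k + 1 : ℝ), G v * v ^ (-α)
      = -W (k + 1) α * G (k + 1) + (W k α + (k : ℝ) ^ (-α)) * G k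
        - ∫ v in (k : ℝ)..(k + 1 : ℝ), G' v * cellKernel α k v := by
  have h1α : 1 - α ≠ 0 := by linarith
  have hGc : Continuous G := continuous_iff_continuousAt.mpr fun v ↦ (hG v).continuousAt
  have h := integral_mul_deriv_eq_deriv_mul_of_hasDerivAt (a := (k : ℝ)) (b := k + 1)
    (u := G) (v := cellKernel α k) (u' := G') (v' := fun v ↦ v ^ (-α))
    hGc.continuousOn (continuous_cellKernel hα1 k).continuousOn (fun v _ ↦ hG v)
    (fun v hv ↦ by
      have hv0 : 0 < v := by
        rw [min_eq_left (by linarith)] at hv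
        exact (Nat.cast_nonneg k).trans_lt hv.1
      have e := Real.hasDerivAt_rpow_const (x := v) (p := 1 - α) (Or.inl hv0.ne')
      refine ((((e.sub_const ((k : ℝ) ^ (1 - α))).div_const (1 - α)).sub_const
        (W k α)).sub_const ((k : ℝ) ^ (-α))).congr_deriv ?_
      rw [show 1 - α - 1 = -α by ring]
      field_simp)
    (hG'.intervalIntegrable _ _) (intervalIntegrable_rpow' (by linarith))
  rw [h]
  have e1 : cellKernel α k (k + 1) = -W (k + 1) α := by
    rw [W_succ hα0 hα1, cellKernel]
    ring
  have e2 : cellKernel α k k = -(W k α + (k : ℝ) ^ (-α)) := by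
    rw [cellKernel]
    ring
  rw [e1, e2]
  ring

lemma abs_integral_cell_zero_le {α : ℝ} (hα0 : 0 < α) (hα1 : α < 1) {G' : ℝ → ℝ} {A : ℝ}
    (hA : ∀ v ∈ Icc (0 : ℝ) 1, |G' v| ≤ A) :
    |∫ v in (0 : ℝ)..1, G' v * cellKernel α 0 v| ≤ (1 / (1 - α) + |zr α|) * A := by
  have h1α : 0 < 1 - α := by linarith
  have h := norm_integral_le_of_norm_le_const (a := (0 : ℝ)) (b := 1)
    (f := fun v ↦ G' v * cellKernel α 0 v) (C := A * (1 / (1 - α) + |zr α|)) (fun v hv ↦ by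
      rw [uIoc_of_le zero_le_one] at hv
      rw [Real.norm_eq_abs, abs_mul]
      refine mul_le_mul (hA v (Ioc_subset_Icc_self hv)) ?_ (abs_nonneg _)
        ((abs_nonneg _).trans (hA v (Ioc_subset_Icc_self hv)))
      have e : cellKernel α 0 v = v ^ (1 - α) / (1 - α) + zr α := by
        simp [cellKernel, W_zero hα1, Real.zero_rpow (neg_ne_zero.mpr hα0.ne'),
          Real.zero_rpow h1α.ne']
      rw [e]
      refine (abs_add_le _ _).trans (add_le_add ?_ le_rfl)
      rw [abs_of_nonneg (div_nonneg (Real.rpow_nonneg hv.1.le _) h1α.le)]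
      exact div_le_div_of_nonneg_right (Real.rpow_le_one hv.1.le hv.2 h1α.le) h1α.le)
  simpa [mul_comm A] using h

lemma abs_cellKernel_sub_le {α : ℝ} (hα0 : 0 < α) (hα1 : α < 1) {k : ℕ} (hk : 1 ≤ k)
    {v : ℝ} (hv : v ∈ Ioc (k : ℝ) (k + 1)) :
    |cellKernel α k v - (k : ℝ) ^ (-α) * (v - k - 1 / 2)| ≤ 2 * (k : ℝ) ^ (-α - 1) := by
  have hk0 : (0 : ℝ) < k := by exact_mod_cast hk
  have h1α : 1 - α ≠ 0 := by linarith
  have hV := abs_W_add_half_le hα0 hα1 hk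
  obtain ⟨c, hc, h⟩ := exists_rpow_sub_rpow_eq hk0 hv.1 (1 - α)
  obtain ⟨d, hd, h'⟩ := exists_rpow_sub_rpow_eq hk0 hc.1 (-α)
  have e : cellKernel α k v - (k : ℝ) ^ (-α) * (v - k - 1 / 2)
      = -(W k α + (k : ℝ) ^ (-α) / 2) + (v - k) * ((c - k) * (-α * d ^ (-α - 1))) := by
    rw [cellKernel, h, ← h', show 1 - α - 1 = -α by ring]
    field_simp
    ring
  have m : d ^ (-α - 1) ≤ (k : ℝ) ^ (-α - 1) :=
    Real.rpow_le_rpow_of_nonpos hk0 hd.1.le (by linarith)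
  have hd0 : 0 ≤ d ^ (-α - 1) := Real.rpow_nonneg (hk0.trans hd.1).le _
  have hvk : |v - k| ≤ 1 := by rw [abs_le]; constructor <;> linarith [hv.1, hv.2]
  have hck : |c - k| ≤ 1 := by rw [abs_le]; constructor <;> linarith [hv.2, hc.1, hc.2]
  have hrem : |(v - k) * ((c - k) * (-α * d ^ (-α - 1)))| ≤ 1 * (1 * (1 * (k : ℝ) ^ (-α - 1))) := by
    rw [abs_mul, abs_mul, abs_mul, abs_neg, abs_of_pos hα0, abs_of_nonneg hd0]
    gcongr
  rw [e]
  refine (abs_add_le _ _).trans ?_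
  rw [abs_neg]
  have : 0 ≤ (k : ℝ) ^ (-α - 1) := by positivity
  nlinarith

lemma abs_integral_cell_le {α : ℝ} (hα0 : 0 < α) (hα1 : α < 1) {k : ℕ} (hk : 1 ≤ k)
    {G' : ℝ → ℝ} (hG' : Continuous G') {A B : ℝ}
    (hA : ∀ v ∈ Icc (k : ℝ) (k + 1), |G' v| ≤ A)
    (hB : ∀ v ∈ Icc (k : ℝ) (k + 1), |G' v - G' k| ≤ B) :
    |∫ v in (k : ℝ)..(k + 1 : ℝ), G' v * cellKernel α k v|
      ≤ 2 * (k : ℝ) ^ (-α - 1) * A + B := by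
  have hk1 : (1 : ℝ) ≤ k := by exact_mod_cast hk
  have hp : (k : ℝ) ^ (-α) ≤ 1 := Real.rpow_le_one_of_one_le_of_nonpos hk1 (by linarith)
  have hp0 : 0 ≤ (k : ℝ) ^ (-α) := by positivity
  have hlin : Continuous fun v : ℝ ↦ G' k * ((k : ℝ) ^ (-α) * (v - k - 1 / 2)) := by fun_prop
  have hzero : ∫ v in (k : ℝ)..(k + 1 : ℝ), G' k * ((k : ℝ) ^ (-α) * (v - k - 1 / 2)) = 0 := by
    have : ∀ v : ℝ, HasDerivAt
        (fun v : ℝ ↦ G' k * ((k : ℝ) ^ (-α) * ((v - k - 1 / 2) ^ 2 / 2)))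
        (G' k * ((k : ℝ) ^ (-α) * (v - k - 1 / 2))) v := fun v ↦ by
      refine ((((((((hasDerivAt_id v).sub_const (k : ℝ)).sub_const (1 / 2)).pow 2).div_const
        2).const_mul ((k : ℝ) ^ (-α)))).const_mul (G' k)).congr_deriv ?_
      simp only [id]
      push_cast
      ring
    rw [integral_eq_sub_of_hasDerivAt (fun v _ ↦ this v)
      (hlin.intervalIntegrable _ _)]
    ring
  have hc := continuous_cellKernel hα1 k
  rw [← sub_zero (∫ v in (k : ℝ)..(k + 1 : ℝ), G' v * cellKernel α k v), ← hzero,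
    ← integral_sub ((hG'.fun_mul hc).intervalIntegrable _ _) (hlin.intervalIntegrable _ _)]
  have h := norm_integral_le_of_norm_le_const (a := (k : ℝ)) (b := k + 1)
    (f := fun v ↦ G' v * cellKernel α k v - G' k * ((k : ℝ) ^ (-α) * (v - k - 1 / 2)))
    (C := 2 * (k : ℝ) ^ (-α - 1) * A + B) (fun v hv ↦ by
      rw [uIoc_of_le (by linarith)] at hv
      have hv' := Ioc_subset_Icc_self hv
      have hvk : |v - k - 1 / 2| ≤ 1 := by rw [abs_le]; constructor <;> linarith [hv.1, hv.2]
      have e : G' v * cellKernel α k v - G' k * ((k : ℝ) ^ (-α) * (v - k - 1 / 2))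
          = (cellKernel α k v - (k : ℝ) ^ (-α) * (v - k - 1 / 2)) * G' v
            + (G' v - G' k) * ((k : ℝ) ^ (-α) * (v - k - 1 / 2)) := by ring
      rw [Real.norm_eq_abs, e]
      refine (abs_add_le _ _).trans (add_le_add ?_ ?_)
      · rw [abs_mul]
        exact mul_le_mul (abs_cellKernel_sub_le hα0 hα1 hk hv) (hA v hv') (abs_nonneg _)
          (by positivity)
      · rw [abs_mul, abs_mul, abs_of_nonneg hp0]
        have hB0 := (abs_nonneg _).trans (hB v hv')
        calc |G' v - G' k| * ((k : ℝ) ^ (-α) * |v - k - 1 / 2|) ≤ B * (1 * 1) := by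
              gcongr
              exact hB v hv'
          _ = B := by ring)
  simpa using h

/-- Error bound for the zeta-corrected quadrature of `∫ G(v) v ^ (-α)` over `[0, n]`. -/
lemma exists_quadrature_bound {α : ℝ} (hα0 : 0 < α) (hα1 : α < 1) :
    ∃ c : ℝ, 0 ≤ c ∧ ∀ (n : ℕ) (A B : ℝ) (G G' : ℝ → ℝ), 1 ≤ n → 0 ≤ A → 0 ≤ B →
      (∀ v, HasDerivAt G (G' v) v) → Continuous G' →
      (∀ v ∈ Icc (0 : ℝ) n, |G' v| ≤ A) →
      (∀ v ∈ Icc (0 : ℝ) n, ∀ w ∈ Icc (0 : ℝ) n, |v - w| ≤ 1 → |G' v - G' w| ≤ B) →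
      |(∑ k ∈ Finset.range n, (k : ℝ) ^ (-α) * G k) - zr α * G 0 - W n α * G n
        - ∫ v in (0 : ℝ)..n, G v * v ^ (-α)| ≤ c * A + n * B := by
  have h1α : 0 < 1 - α := by linarith
  have hsum := summable_nat_add_one_rpow (p := -α - 1) (by linarith)
  refine ⟨(1 / (1 - α) + |zr α|) + 2 * ∑' n : ℕ, (n + 1 : ℝ) ^ (-α - 1), ?_, ?_⟩
  · have : 0 ≤ ∑' n : ℕ, (n + 1 : ℝ) ^ (-α - 1) := tsum_nonneg fun n ↦ by positivity
    positivity
  intro n A B G G' hn hA0 hB0 hG hG' hA hB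
  have hGc : Continuous G := continuous_iff_continuousAt.mpr fun v ↦ (hG v).continuousAt
  have hint : ∀ a b : ℝ, IntervalIntegrable (fun v ↦ G v * v ^ (-α)) volume a b := fun a b ↦
    (intervalIntegrable_rpow' (by linarith)).continuousOn_mul hGc.continuousOn
  have hsplit := sum_integral_adjacent_intervals (f := fun v ↦ G v * v ^ (-α))
    (μ := volume) (a := fun k : ℕ ↦ (k : ℝ)) (n := n) (fun k _ ↦ hint _ _)
  have htel : ∀ m : ℕ, (∑ k ∈ Finset.range m, ∫ v in (k : ℝ)..((k + 1 : ℕ) : ℝ), G v * v ^ (-α))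
      = (∑ k ∈ Finset.range m, (k : ℝ) ^ (-α) * G k) - zr α * G 0 - W m α * G m
        - ∑ k ∈ Finset.range m, ∫ v in (k : ℝ)..(k + 1 : ℝ), G' v * cellKernel α k v := by
    intro m
    induction m with
    | zero => simp [W_zero hα1]
    | succ m ih =>
      rw [Finset.sum_range_succ, ih, Finset.sum_range_succ, Finset.sum_range_succ]
      push_cast
      rw [integral_cell hα0 hα1 hG hG' m]
      ring
  rw [Nat.cast_zero] at hsplit
  rw [← hsplit, htel n, sub_sub_cancel]
  obtain ⟨m, rfl⟩ : ∃ m, n = m + 1 := ⟨n - 1, by omega⟩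
  refine (Finset.abs_sum_le_sum_abs _ _).trans ?_
  rw [Finset.sum_range_succ']
  push_cast at hA hB ⊢
  have h0 : |∫ v in (0 : ℝ)..(0 + 1 : ℝ), G' v * cellKernel α 0 v|
      ≤ (1 / (1 - α) + |zr α|) * A := by
    rw [zero_add]
    refine abs_integral_cell_zero_le hα0 hα1 fun v hv ↦ hA v ⟨hv.1, hv.2.trans ?_⟩
    linarith [Nat.cast_nonneg (α := ℝ) m]
  have hcell : ∀ k ∈ Finset.range m,
      |∫ v in (k + 1 : ℝ)..(k + 1 + 1 : ℝ), G' v * cellKernel α (k + 1) v|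
        ≤ 2 * A * (k + 1 : ℝ) ^ (-α - 1) + B := by
    intro k hk
    have hkm : (k : ℝ) + 1 ≤ m := by exact_mod_cast Finset.mem_range.mp hk
    have hk0 := Nat.cast_nonneg (α := ℝ) k
    have h := abs_integral_cell_le hα0 hα1 (k := k + 1) (by omega) hG' (A := A) (B := B)
      (fun v hv ↦ hA v ⟨by push_cast at hv; linarith [hv.1], by push_cast at hv; linarith [hv.2]⟩)
      (fun v hv ↦ by
        push_cast at hv ⊢
        refine hB v ⟨by linarith [hv.1], by linarith [hv.2]⟩ _ ⟨by linarith, by linarith⟩ ?_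
        rw [abs_le]
        constructor <;> linarith [hv.1, hv.2])
    push_cast at h
    linarith
  have htsum := hsum.sum_le_tsum (Finset.range m) (fun k _ ↦ by positivity)
  have hs := Finset.sum_le_sum hcell
  rw [Finset.sum_add_distrib, ← Finset.mul_sum, Finset.sum_const, Finset.card_range,
    nsmul_eq_mul] at hs
  have := mul_le_mul_of_nonneg_left htsum hA0
  linarith

lemma exists_sub_eq_mul_of_hasDerivAt {f f₁ : ℝ → ℝ} (hf : ∀ t, HasDerivAt f (f₁ t) t)
    {a b : ℝ} (hab : a < b) : ∃ ξ ∈ Ioo a b, f b - f a = (b - a) * f₁ ξ := by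
  obtain ⟨ξ, hξ, h⟩ := exists_hasDerivAt_eq_slope f f₁ hab
    (fun v _ ↦ (hf v).continuousAt.continuousWithinAt) (fun v _ ↦ hf v)
  have : b - a ≠ 0 := by linarith
  exact ⟨ξ, hξ, by rw [h]; field_simp⟩

lemma abs_sub_le_of_hasDerivAt {f f₁ : ℝ → ℝ} (hf : ∀ t, HasDerivAt f (f₁ t) t) {x M : ℝ}
    (hM : ∀ t ∈ Icc 0 x, |f₁ t| ≤ M) {a b : ℝ} (ha : a ∈ Icc 0 x) (hb : b ∈ Icc 0 x) :
    |f b - f a| ≤ M * |b - a| :=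
  (convex_Icc 0 x).norm_image_sub_le_of_norm_hasDerivWithin_le
    (fun t _ ↦ (hf t).hasDerivWithinAt) hM ha hb

lemma abs_forward_difference_le {f f₁ f₂ : ℝ → ℝ} (hf : ∀ t, HasDerivAt f (f₁ t) t)
    (hf₁ : ∀ t, HasDerivAt f₁ (f₂ t) t) {x M : ℝ} (hM0 : 0 ≤ M)
    (hM : ∀ t ∈ Icc 0 x, |f₂ t| ≤ M) {a h c : ℝ} (hh : 0 < h) (ha : 0 ≤ a) (hah : a + h ≤ x)
    (hc : c ∈ Icc a (a + h)) : |f (a + h) - f a - h * f₁ c| ≤ M * h ^ 2 := by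
  obtain ⟨ξ, hξ, e⟩ := exists_sub_eq_mul_of_hasDerivAt hf (lt_add_of_pos_right a hh)
  have hL := abs_sub_le_of_hasDerivAt hf₁ hM (a := c) (b := ξ)
    ⟨ha.trans hc.1, hc.2.trans hah⟩ ⟨ha.trans hξ.1.le, hξ.2.le.trans hah⟩
  have hd : |ξ - c| ≤ h := by
    rw [abs_le]
    constructor <;> linarith [hξ.1, hξ.2, hc.1, hc.2]
  rw [e, show (a + h - a) * f₁ ξ - h * f₁ c = h * (f₁ ξ - f₁ c) by ring, abs_mul, abs_of_pos hh]
  calc h * |f₁ ξ - f₁ c| ≤ h * (M * h) := by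
        gcongr
        exact hL.trans (by gcongr)
    _ = M * h ^ 2 := by ring

lemma abs_central_difference_le {f f₁ f₂ f₃ : ℝ → ℝ} (hf : ∀ t, HasDerivAt f (f₁ t) t)
    (hf₁ : ∀ t, HasDerivAt f₁ (f₂ t) t) (hf₂ : ∀ t, HasDerivAt f₂ (f₃ t) t) {x M : ℝ}
    (hM0 : 0 ≤ M) (hM : ∀ t ∈ Icc 0 x, |f₃ t| ≤ M) {c h : ℝ} (hh : 0 < h) (hc : 0 ≤ c - h)
    (hch : c + h ≤ x) : |f (c + h) - f (c - h) - 2 * h * f₁ c| ≤ 2 * M * h ^ 3 := by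
  have hφ : ∀ t, HasDerivAt (fun t ↦ f (c + t) - f (c - t) - 2 * t * f₁ c)
      (f₁ (c + t) + f₁ (c - t) - 2 * f₁ c) t := fun t ↦ by
    have h1 := (hf (c + t)).comp_const_add c t
    have h2 := (hf (c - t)).comp_const_sub c t
    refine ((h1.sub h2).sub (((hasDerivAt_id t).const_mul 2).mul_const (f₁ c))).congr_deriv ?_
    ring
  obtain ⟨t, ht, e⟩ := exists_sub_eq_mul_of_hasDerivAt hφ hh
  obtain ⟨ξ, hξ, e1⟩ := exists_sub_eq_mul_of_hasDerivAt hf₁ (lt_add_of_pos_right c ht.1)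
  obtain ⟨η, hη, e2⟩ := exists_sub_eq_mul_of_hasDerivAt hf₁ (sub_lt_self c ht.1)
  have hL := abs_sub_le_of_hasDerivAt hf₂ hM (a := η) (b := ξ)
    ⟨by linarith [hη.1, ht.2], by linarith [hη.2]⟩
    ⟨by linarith [hξ.1], by linarith [hξ.2, ht.2]⟩
  have hd : |ξ - η| ≤ 2 * h := by
    rw [abs_le]
    constructor <;> linarith [hξ.1, hξ.2, hη.1, hη.2, ht.1, ht.2]
  have key : f (c + h) - f (c - h) - 2 * h * f₁ c = h * (t * (f₂ ξ - f₂ η)) := by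
    simp only [add_zero, sub_zero, mul_zero, zero_mul, sub_self] at e
    rw [e]
    linear_combination h * (e1 - e2)
  rw [key, abs_mul, abs_mul, abs_of_pos hh, abs_of_pos ht.1]
  calc h * (t * |f₂ ξ - f₂ η|) ≤ h * (h * (M * (2 * h))) := by
        have := ht.1
        have := ht.2
        gcongr
        exact hL.trans (by gcongr)
    _ = 2 * M * h ^ 3 := by ring

lemma sum_mul_sub_eq_sum_by_parts (w z : ℕ → ℝ) (m : ℕ) :
    ∑ k ∈ Finset.range (m + 3), w (k + 1) * (z k - z (k + 2))
      = w 1 * z 0 + w 2 * z 1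
        + (∑ k ∈ Finset.Icc 2 (m + 2), (w (k + 1) - w (k - 1)) * z k)
        - w (m + 2) * z (m + 3) - w (m + 3) * z (m + 4) := by
  induction m with
  | zero =>
    simp [Finset.sum_range_succ]
    ring
  | succ m ih =>
    have h := Finset.sum_Icc_succ_top (show 2 ≤ (m + 2) + 1 by omega)
      (fun k ↦ (w (k + 1) - w (k - 1)) * z k)
    rw [show m + 1 + 3 = (m + 3) + 1 by ring, Finset.sum_range_succ, ih,
      show m + 1 + 2 = (m + 2) + 1 by ring, h, Nat.add_sub_cancel]
    ring_nf

lemma caputo_eq_rescaled {α x h : ℝ} (hh : 0 < h) {n : ℕ} (hx : h * n = x)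
    (y : ℝ → ℝ) :
    caputo α y x = 1 / Real.Gamma (1 - α) *
      (h * h ^ (-α) * ∫ v in (0 : ℝ)..n, deriv y (x - h * v) * v ^ (-α)) := by
  have e := integral_comp_sub_mul (a := 0) (b := n) (fun t ↦ deriv y t / (x - t) ^ α) hh.ne' x
  rw [mul_zero, sub_zero, hx, sub_self, smul_eq_mul] at e
  have e2 : ∫ v in (0 : ℝ)..n, deriv y (x - h * v) / (x - (x - h * v)) ^ α
      = h ^ (-α) * ∫ v in (0 : ℝ)..n, deriv y (x - h * v) * v ^ (-α) := by
    rw [← intervalIntegral.integral_const_mul]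
    refine integral_congr fun v hv ↦ ?_
    rw [uIcc_of_le (Nat.cast_nonneg n)] at hv
    simp only [sub_sub_cancel]
    rw [Real.mul_rpow hh.le hv.1, Real.rpow_neg hh.le, Real.rpow_neg hv.1, div_eq_mul_inv,
      mul_inv]
    ring
  rw [caputo, mul_assoc h, ← e2, e, mul_inv_cancel_left₀ hh.ne']

lemma exists_abs_le_on_Icc {f : ℝ → ℝ} (hf : Continuous f) (x : ℝ) :
    ∃ M, 0 ≤ M ∧ ∀ t ∈ Icc 0 x, |f t| ≤ M := by
  obtain ⟨M, hM⟩ := isCompact_Icc.exists_bound_of_continuousOn (s := Icc 0 x) hf.continuousOn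
  exact ⟨max M 0, le_max_right _ _, fun t ht ↦ (hM t ht).trans (le_max_left _ _)⟩

/-- The zeta-corrected sum of central differences, compared with the rescaled integral. -/
lemma exists_difference_sum_bound {α x : ℝ} (hα0 : 0 < α) (hα1 : α < 1) (hx : 0 < x)
    {y : ℝ → ℝ} (hy : ContDiff ℝ (⊤ : ℕ∞) y) :
    ∃ D > 0, ∀ (m : ℕ) (h : ℝ), h * (m + 4 : ℕ) = x →
      |(∑ k ∈ Finset.range (m + 3), ((k + 1 : ℕ) : ℝ) ^ (-α)
            * (y (x - h * k) - y (x - h * (k + 2 : ℕ))))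
          - 2 * zr α * (y x - y (x - h)) - 2 * W (m + 4) α * (y h - y 0)
          - 2 * h * ∫ v in (0 : ℝ)..(m + 4 : ℕ), deriv y (x - h * v) * v ^ (-α)|
        ≤ D * h ^ 2 := by
  obtain ⟨hy0, hy1⟩ := contDiff_infty_iff_deriv.mp hy
  obtain ⟨hg0, hg1⟩ := contDiff_infty_iff_deriv.mp hy1
  obtain ⟨hp0, hp1⟩ := contDiff_infty_iff_deriv.mp hg1
  set g := deriv y with hg_def
  set p := deriv g with hp_def
  have hyd : ∀ t, HasDerivAt y (g t) t := fun t ↦ (hy0 t).hasDerivAt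
  have hgd : ∀ t, HasDerivAt g (p t) t := fun t ↦ (hg0 t).hasDerivAt
  have hpd : ∀ t, HasDerivAt p (deriv p t) t := fun t ↦ (hp0 t).hasDerivAt
  obtain ⟨M₂, hM₂0, hM₂⟩ := exists_abs_le_on_Icc hg1.continuous x
  obtain ⟨M₃, hM₃0, hM₃⟩ := exists_abs_le_on_Icc hp1.continuous x
  obtain ⟨c, hc0, hquad⟩ := exists_quadrature_bound hα0 hα1
  refine ⟨2 * M₃ * x + 2 * |zr α| * M₂ + 2 * M₂ + 2 * (c * M₂ + x * M₃) + 1,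
    by positivity, fun m h hmx ↦ ?_⟩
  have hn0 : (0 : ℝ) < (m + 4 : ℕ) := by positivity
  have hh : 0 < h := pos_of_mul_pos_left (hmx ▸ hx) hn0.le
  have hmem : ∀ v ∈ Icc (0 : ℝ) (m + 4 : ℕ), x - h * v ∈ Icc 0 x := fun v hv ↦ by
    have h1 := mul_le_mul_of_nonneg_left hv.2 hh.le
    have h2 := mul_nonneg hh.le hv.1
    constructor <;> linarith
  have hG : ∀ v, HasDerivAt (fun v ↦ g (x - h * v)) (-h * p (x - h * v)) v := fun v ↦ by
    have h1 : HasDerivAt (fun v ↦ x - h * v) (-h) v := by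
      simpa using ((hasDerivAt_id v).const_mul h).const_sub x
    exact ((hgd _).comp v h1).congr_deriv (mul_comm _ _)
  have hq := hquad (m + 4) (h * M₂) (h ^ 2 * M₃) (fun v ↦ g (x - h * v))
    (fun v ↦ -h * p (x - h * v)) (by omega) (by positivity) (by positivity) hG
    (by have := hg1.continuous; fun_prop)
    (fun v hv ↦ by
      rw [abs_mul, abs_neg, abs_of_pos hh]
      exact mul_le_mul_of_nonneg_left (hM₂ _ (hmem v hv)) hh.le)
    (fun v hv w hw hvw ↦ by
      have hL := abs_sub_le_of_hasDerivAt hpd hM₃ (hmem w hw) (hmem v hv)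
      rw [show x - h * v - (x - h * w) = -h * (v - w) by ring, abs_mul, abs_neg,
        abs_of_pos hh] at hL
      rw [← mul_sub, abs_mul, abs_neg, abs_of_pos hh]
      calc h * |p (x - h * v) - p (x - h * w)| ≤ h * (M₃ * (h * 1)) := by
            gcongr
            exact hL.trans (by gcongr)
        _ = h ^ 2 * M₃ := by ring)
  have hend : x - h * ((m + 4 : ℕ) : ℝ) = 0 := by linarith
  simp only [hend, mul_zero, sub_zero] at hq
  rw [show m + 4 = (m + 3) + 1 by ring, Finset.sum_range_succ'] at hq
  rw [Nat.cast_zero, Real.zero_rpow (neg_ne_zero.mpr hα0.ne'), zero_mul, add_zero,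
    show m + 3 + 1 = m + 4 by ring] at hq
  have hsumb : |∑ k ∈ Finset.range (m + 3), ((k + 1 : ℕ) : ℝ) ^ (-α)
      * (y (x - h * k) - y (x - h * (k + 2 : ℕ)) - 2 * h * g (x - h * (k + 1 : ℕ)))|
      ≤ 2 * M₃ * x * h ^ 2 := by
    have hterm : ∀ k ∈ Finset.range (m + 3), |((k + 1 : ℕ) : ℝ) ^ (-α)
        * (y (x - h * k) - y (x - h * (k + 2 : ℕ)) - 2 * h * g (x - h * (k + 1 : ℕ)))|
        ≤ 2 * M₃ * h ^ 3 := fun k hk ↦ by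
      have hkm : ((k + 2 : ℕ) : ℝ) ≤ (m + 4 : ℕ) := by
        have := Finset.mem_range.mp hk
        exact_mod_cast (by omega : k + 2 ≤ m + 4)
      have h1 := (hmem ((k + 2 : ℕ) : ℝ) ⟨by positivity, hkm⟩).1
      have h2 := (hmem (k : ℝ) ⟨by positivity, by push_cast at hkm ⊢; linarith⟩).2
      have hcd := abs_central_difference_le hyd hgd hpd hM₃0 hM₃ (c := x - h * (k + 1 : ℕ)) hh
        (by push_cast at h1 ⊢; linarith) (by push_cast; linarith)
      rw [show x - h * ((k + 1 : ℕ) : ℝ) + h = x - h * k by push_cast; ring,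
        show x - h * ((k + 1 : ℕ) : ℝ) - h = x - h * (k + 2 : ℕ) by push_cast; ring] at hcd
      have hw : ((k + 1 : ℕ) : ℝ) ^ (-α) ≤ 1 :=
        Real.rpow_le_one_of_one_le_of_nonpos (by simp) (by linarith)
      rw [abs_mul, abs_of_nonneg (by positivity : (0 : ℝ) ≤ ((k + 1 : ℕ) : ℝ) ^ (-α))]
      exact (mul_le_of_le_one_left (abs_nonneg _) hw).trans hcd
    refine (Finset.abs_sum_le_sum_abs _ _).trans ((Finset.sum_le_sum hterm).trans ?_)
    rw [Finset.sum_const, Finset.card_range, nsmul_eq_mul]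
    have hle : h * ((m + 3 : ℕ) : ℝ) ≤ x := by
      rw [← hmx]
      push_cast
      gcongr
      norm_num
    calc ((m + 3 : ℕ) : ℝ) * (2 * M₃ * h ^ 3)
        = 2 * M₃ * h ^ 2 * (h * ((m + 3 : ℕ) : ℝ)) := by ring
      _ ≤ 2 * M₃ * h ^ 2 * x := by gcongr
      _ = 2 * M₃ * x * h ^ 2 := by ring
  have hhx : h ≤ x := by
    rw [← hmx]
    push_cast
    nlinarith [Nat.cast_nonneg (α := ℝ) m]
  have hleft := abs_forward_difference_le hyd hgd hM₂0 hM₂ (a := x - h) (c := x) hh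
    (by linarith) (by linarith) ⟨by linarith, by linarith⟩
  have hright := abs_forward_difference_le hyd hgd hM₂0 hM₂ (a := 0) (c := 0) hh
    le_rfl (by linarith) ⟨le_rfl, by linarith⟩
  rw [sub_add_cancel] at hleft
  rw [zero_add] at hright
  set J := ∫ v in (0 : ℝ)..(m + 4 : ℕ), g (x - h * v) * v ^ (-α)
  set Q := ∑ k ∈ Finset.range (m + 3), ((k + 1 : ℕ) : ℝ) ^ (-α) * g (x - h * (k + 1 : ℕ))
    with hQ
  have hdecomp : (∑ k ∈ Finset.range (m + 3), ((k + 1 : ℕ) : ℝ) ^ (-α)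
            * (y (x - h * k) - y (x - h * (k + 2 : ℕ))))
          - 2 * zr α * (y x - y (x - h)) - 2 * W (m + 4) α * (y h - y 0) - 2 * h * J
      = (∑ k ∈ Finset.range (m + 3), ((k + 1 : ℕ) : ℝ) ^ (-α)
          * (y (x - h * k) - y (x - h * (k + 2 : ℕ)) - 2 * h * g (x - h * (k + 1 : ℕ))))
        - 2 * zr α * (y x - y (x - h) - h * g x) - 2 * W (m + 4) α * (y h - y 0 - h * g 0)
        + 2 * h * (Q - zr α * g x - W (m + 4) α * g 0 - J) := by
    have : ∑ k ∈ Finset.range (m + 3), ((k + 1 : ℕ) : ℝ) ^ (-α)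
          * (y (x - h * k) - y (x - h * (k + 2 : ℕ)) - 2 * h * g (x - h * (k + 1 : ℕ)))
        = (∑ k ∈ Finset.range (m + 3), ((k + 1 : ℕ) : ℝ) ^ (-α)
            * (y (x - h * k) - y (x - h * (k + 2 : ℕ)))) - 2 * h * Q := by
      rw [hQ, Finset.mul_sum, ← Finset.sum_sub_distrib]
      exact Finset.sum_congr rfl fun k _ ↦ by ring
    rw [this]
    ring
  rw [hdecomp]
  have hW := abs_W_le_one hα0 hα1 (n := m + 4) (by omega)
  have b1 : |2 * zr α * (y x - y (x - h) - h * g x)| ≤ 2 * |zr α| * (M₂ * h ^ 2) := by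
    rw [abs_mul, abs_mul, abs_two]
    gcongr
  have b2 : |2 * W (m + 4) α * (y h - y 0 - h * g 0)| ≤ 2 * 1 * (M₂ * h ^ 2) := by
    rw [abs_mul, abs_mul, abs_two]
    gcongr
  have b3 : |2 * h * (Q - zr α * g x - W (m + 4) α * g 0 - J)|
      ≤ 2 * (c * M₂ + x * M₃) * h ^ 2 := by
    rw [abs_mul, abs_mul, abs_two, abs_of_pos hh]
    calc _ ≤ 2 * h * (c * (h * M₂) + ((m + 4 : ℕ) : ℝ) * (h ^ 2 * M₃)) := by gcongr
      _ = 2 * (c * M₂ + h * ((m + 4 : ℕ) : ℝ) * M₃) * h ^ 2 := by ring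
      _ = _ := by rw [hmx]
  refine (abs_add_le _ _).trans ?_
  refine (add_le_add ((abs_sub _ _).trans (add_le_add (abs_sub _ _) le_rfl)) le_rfl).trans ?_
  nlinarith [sq_nonneg h]

end

theorem approx_order_two_sub_alpha
    (α x : ℝ) (hα0 : 0 < α) (hα1 : α < 1) (hx : 0 < x)
    (y : ℝ → ℝ) (hy : ContDiff ℝ (⊤ : ℕ∞) y) :
    ∃ C > 0, ∀ n : ℕ, 4 ≤ n →
      |(1 / (2 * Real.Gamma (1 - α) * (x / n) ^ α)) *
          ((1 - 2 * zr α) * y x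
            + ((2:ℝ) ^ (-α) + 2 * zr α) * y (x - x / n)
            + (∑ k ∈ Finset.Icc 2 (n - 2),
                (((k:ℝ) + 1) ^ (-α) - ((k:ℝ) - 1) ^ (-α)) * y (x - (k:ℝ) * (x / n)))
            + (-(((n:ℝ) - 2) ^ (-α)) - 2 * W n α) * y (x - ((n:ℝ) - 1) * (x / n))
            + (-(((n:ℝ) - 1) ^ (-α)) + 2 * W n α) * y (x - (n:ℝ) * (x / n)))
        - caputo α y x|
      ≤ C * (x / n) ^ (2 - α) := by
  obtain ⟨D, hD, hbound⟩ := exists_difference_sum_bound hα0 hα1 hx hy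
  have hΓ : 0 < Real.Gamma (1 - α) := Real.Gamma_pos_of_pos (by linarith)
  refine ⟨D / (2 * Real.Gamma (1 - α)), by positivity, fun n hn ↦ ?_⟩
  obtain ⟨m, rfl⟩ : ∃ m, n = m + 4 := ⟨n - 4, by omega⟩
  have hn0 : (0 : ℝ) < (m + 4 : ℕ) := by positivity
  set h : ℝ := x / (m + 4 : ℕ) with hh_def
  have hh : 0 < h := by positivity
  have hmx : h * (m + 4 : ℕ) = x := div_mul_cancel₀ x hn0.ne'
  have hb := hbound m h hmx
  rw [caputo_eq_rescaled hh hmx]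
  set J := ∫ v in (0 : ℝ)..(m + 4 : ℕ), deriv y (x - h * v) * v ^ (-α)
  have hparts := sum_mul_sub_eq_sum_by_parts (fun k ↦ (k : ℝ) ^ (-α))
    (fun k ↦ y (x - h * k)) m
  have hIcc : ∑ k ∈ Finset.Icc 2 (m + 4 - 2),
        (((k : ℝ) + 1) ^ (-α) - ((k : ℝ) - 1) ^ (-α)) * y (x - (k : ℝ) * h)
      = ∑ k ∈ Finset.Icc 2 (m + 2),
        (((k + 1 : ℕ) : ℝ) ^ (-α) - ((k - 1 : ℕ) : ℝ) ^ (-α)) * y (x - h * k) := by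
    refine Finset.sum_congr rfl fun k hk ↦ ?_
    rw [Nat.cast_sub (by linarith [(Finset.mem_Icc.mp hk).1]), mul_comm h]
    push_cast
    rfl
  have hlast : x - h * ((m + 4 : ℕ) : ℝ) = 0 := by linarith
  have hlast' : x - h * ((m + 3 : ℕ) : ℝ) = h := by push_cast at hlast ⊢; linarith
  simp only [hlast, hlast'] at hparts
  have e0 : x - ((m + 4 : ℕ) : ℝ) * h = 0 := by linarith
  have e1 : x - (((m + 4 : ℕ) : ℝ) - 1) * h = h := by linarith
  have e2 : ((m + 4 : ℕ) : ℝ) - 2 = ((m + 2 : ℕ) : ℝ) := by push_cast; ring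
  have e3 : ((m + 4 : ℕ) : ℝ) - 1 = ((m + 3 : ℕ) : ℝ) := by push_cast; ring
  rw [hparts] at hb
  rw [hIcc, e0, e1, e2, e3]
  simp only [Nat.cast_one, Real.one_rpow, Nat.cast_zero, mul_zero, sub_zero, mul_one, one_mul,
    Nat.cast_ofNat] at hb
  set T := ∑ k ∈ Finset.Icc 2 (m + 2),
    (((k + 1 : ℕ) : ℝ) ^ (-α) - ((k - 1 : ℕ) : ℝ) ^ (-α)) * y (x - h * k)
  have hpow : 0 < h ^ α := Real.rpow_pos_of_pos hh α
  have hpow2 : h ^ (2 - α) = h ^ 2 / h ^ α := by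
    rw [Real.rpow_sub hh, Real.rpow_two]
  rw [hpow2, Real.rpow_neg hh.le]
  have hrw : D / (2 * Real.Gamma (1 - α)) * (h ^ 2 / h ^ α)
      = 1 / (2 * Real.Gamma (1 - α) * h ^ α) * (D * h ^ 2) := by
    field_simp
  rw [hrw]
  refine le_trans (le_of_eq ?_) (mul_le_mul_of_nonneg_left hb (by positivity))
  rw [← abs_of_nonneg (by positivity : 0 ≤ 1 / (2 * Real.Gamma (1 - α) * h ^ α)), ← abs_mul,
    abs_of_nonneg (by positivity : 0 ≤ 1 / (2 * Real.Gamma (1 - α) * h ^ α))]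
  congr 1
  field_simp
  ring
end

section
/- (Second-order approximation of the Caputo derivative.) Let 0 < α < 1, x > 0, and let y be smooth (C^∞) on [0, x] with y'(0) = 0. Define W_n[α] = Σ_{k=1}^{n−1} k^{−α} − n^{1−α}/(1−α) − ζ(α) and the weights δ₀ = 1 − 3ζ(α) + 2ζ(α−1), δ₁ = 2^{−α} + 4ζ(α) − 4ζ(α−1), δ₂ = 3^{−α} − 1 − ζ(α) + 2ζ(α−1), δ_k = (k+1)^{−α} − (k−1)^{−α} for 3 ≤ k ≤ n−2, δ_{n−1} = −(n−2)^{−α} − 2W_n[α], δ_n = −(n−1)^{−α} + 2W_n[α]. Then there exists C > 0 (independent of n) such that for all integers n ≥ 5, with h = x/n, | (1/(2Γ(1−α)h^α)) Σ_{k=0}^{n} δ_k y(x−kh) − D^α y(x) | ≤ C h². -/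
open Filter Topology

/-- Error of the trapezoidal rule on `[a, b]`, in terms of an antiderivative `Φ` of `F`. -/
theorem norm_trapezoid_error_le {E : Type*} [NormedAddCommGroup E] [NormedSpace ℝ E]
    {Φ F F' F'' : ℝ → E} {a b M : ℝ} (hab : a ≤ b)
    (h0 : ∀ t ∈ Set.Icc a b, HasDerivAt Φ (F t) t)
    (h1 : ∀ t ∈ Set.Icc a b, HasDerivAt F (F' t) t)
    (h2 : ∀ t ∈ Set.Icc a b, HasDerivAt F' (F'' t) t)
    (hM : ∀ t ∈ Set.Icc a b, ‖F'' t‖ ≤ M) :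
    ‖Φ b - Φ a - ((b - a) / 2) • (F a + F b)‖ ≤ M * (b - a) ^ 3 := by
  have hM0 : 0 ≤ M := (norm_nonneg _).trans (hM a ⟨le_rfl, hab⟩)
  have key1 : ∀ t ∈ Set.Icc a b, ‖F t - F a - (t - a) • F' t‖ ≤ M * (b - a) ^ 2 := by
    intro t ht
    have hψ : ∀ u ∈ Set.Icc a b, HasDerivWithinAt (fun u => F u - (u - a) • F' u)
        (-((u - a) • F'' u)) (Set.Icc a b) u := by
      intro u hu
      have := (h1 u hu).sub ((((hasDerivAt_id u).sub_const a)).smul (h2 u hu))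
      refine HasDerivAt.hasDerivWithinAt ?_
      convert! this using 1
      simp
    have hb : ∀ u ∈ Set.Ico a b, ‖-((u - a) • F'' u)‖ ≤ M * (b - a) := by
      intro u hu
      have hu' := Set.Ico_subset_Icc_self hu
      rw [norm_neg, norm_smul, Real.norm_of_nonneg (by linarith [hu.1]), mul_comm]
      exact mul_le_mul (hM u hu') (by linarith [hu'.2]) (by linarith [hu.1]) hM0
    have := norm_image_sub_le_of_norm_deriv_le_segment' hψ hb t ht
    simp only [sub_self, zero_smul, sub_zero] at this
    calc ‖F t - F a - (t - a) • F' t‖ = ‖F t - (t - a) • F' t - F a‖ := by congr 1; abel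
      _ ≤ M * (b - a) * (t - a) := this
      _ ≤ M * (b - a) * (b - a) := by
        have : 0 ≤ b - a := by linarith
        gcongr
        exact ht.2
      _ = _ := by ring
  have hφ : ∀ u ∈ Set.Icc a b, HasDerivWithinAt
      (fun u => Φ u - ((u - a) / 2) • (F a + F u))
      ((1 / 2 : ℝ) • (F u - F a - (u - a) • F' u)) (Set.Icc a b) u := by
    intro u hu
    have := (h0 u hu).sub ((((hasDerivAt_id u).sub_const a).div_const 2).smul
      ((h1 u hu).const_add (F a)))
    refine HasDerivAt.hasDerivWithinAt ?_
    convert! this using 1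
    simp only [id]
    module
  have hb : ∀ u ∈ Set.Ico a b, ‖(1 / 2 : ℝ) • (F u - F a - (u - a) • F' u)‖
      ≤ M * (b - a) ^ 2 := by
    intro u hu
    rw [norm_smul]
    have := key1 u (Set.Ico_subset_Icc_self hu)
    have h3 := norm_nonneg (F u - F a - (u - a) • F' u)
    norm_num
    linarith
  have := norm_image_sub_le_of_norm_deriv_le_segment' hφ hb b ⟨hab, le_rfl⟩
  simp only [sub_self, zero_div, zero_smul, sub_zero] at this
  calc _ = ‖Φ b - ((b - a) / 2) • (F a + F b) - Φ a‖ := by congr 1; abel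
    _ ≤ _ := this
    _ = _ := by ring

theorem hasDerivAt_ofReal_cpow_of_pos (c : ℂ) {t : ℝ} (ht : 0 < t) :
    HasDerivAt (fun u : ℝ => (u : ℂ) ^ c) (c * (t : ℂ) ^ (c - 1)) t := by
  rcases eq_or_ne c 0 with rfl | hc
  · simpa using hasDerivAt_const t (1 : ℂ)
  · exact hasDerivAt_ofReal_cpow_const ht.ne' hc

/-- `(s - 1)` times the trapezoidal error of `t ↦ t ^ (-s)` on `[n + 1, n + 2]`. -/
noncomputable def zetaTrapezoid (n : ℕ) (s : ℂ) : ℂ :=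
  ((n + 1 : ℝ) : ℂ) ^ (1 - s) - ((n + 2 : ℝ) : ℂ) ^ (1 - s)
    - (s - 1) / 2 * (((n + 1 : ℝ) : ℂ) ^ (-s) + ((n + 2 : ℝ) : ℂ) ^ (-s))

theorem differentiable_zetaTrapezoid (n : ℕ) : Differentiable ℂ (zetaTrapezoid n) := by
  have h1 : ((n + 1 : ℝ) : ℂ) ≠ 0 := by exact_mod_cast (by positivity : (n + 1 : ℝ) ≠ 0)
  have h2 : ((n + 2 : ℝ) : ℂ) ≠ 0 := by exact_mod_cast (by positivity : (n + 2 : ℝ) ≠ 0)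
  have (z : ℂ) (hz : z ≠ 0) (f : ℂ → ℂ) (hf : Differentiable ℂ f) :
      Differentiable ℂ fun s => z ^ f s :=
    hf.const_cpow (Or.inl hz)
  unfold zetaTrapezoid
  exact (((this _ h1 _ (by fun_prop)).sub (this _ h2 _ (by fun_prop))).sub
    ((by fun_prop : Differentiable ℂ fun s : ℂ => (s - 1) / 2).mul
      ((this _ h1 _ (by fun_prop)).add (this _ h2 _ (by fun_prop)))))

theorem norm_zetaTrapezoid_le (n : ℕ) {s : ℂ} (hs : -1 < s.re) :
    ‖zetaTrapezoid n s‖ ≤ ‖(s - 1) * s * (s + 1)‖ * (n + 1 : ℝ) ^ (-s.re - 2) := by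
  have hpos : ∀ t ∈ Set.Icc (n + 1 : ℝ) (n + 2), 0 < t := fun t ht =>
    lt_of_lt_of_le (by positivity) ht.1
  have := norm_trapezoid_error_le (E := ℂ) (a := (n + 1 : ℝ)) (b := n + 2)
    (Φ := fun t : ℝ => -(t : ℂ) ^ (1 - s)) (F := fun t : ℝ => (s - 1) * (t : ℂ) ^ (-s))
    (F' := fun t : ℝ => (s - 1) * (-s * (t : ℂ) ^ (-s - 1)))
    (F'' := fun t : ℝ => (s - 1) * (-s * ((-s - 1) * (t : ℂ) ^ (-s - 1 - 1))))
    (M := ‖(s - 1) * s * (s + 1)‖ * (n + 1 : ℝ) ^ (-s.re - 2)) (by linarith)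
    (fun t ht => by
      convert! (hasDerivAt_ofReal_cpow_of_pos (1 - s) (hpos t ht)).neg using 1
      rw [show (1 - s - 1) = -s by ring]; ring)
    (fun t ht => (hasDerivAt_ofReal_cpow_of_pos (-s) (hpos t ht)).const_mul _)
    (fun t ht => ((hasDerivAt_ofReal_cpow_of_pos (-s - 1) (hpos t ht)).const_mul _).const_mul _)
    (fun t ht => by
      have e : (s - 1) * (-s * ((-s - 1) * (t : ℂ) ^ (-s - 1 - 1)))
        = (s - 1) * s * (s + 1) * (t : ℂ) ^ (-s - 1 - 1) := by ring
      rw [e, norm_mul, Complex.norm_cpow_eq_rpow_re_of_pos (hpos t ht)]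
      have e2 : (-s - 1 - 1).re = -s.re - 2 := by simp; ring
      rw [e2]
      exact mul_le_mul_of_nonneg_left
        (Real.rpow_le_rpow_of_nonpos (by positivity) ht.1 (by linarith)) (norm_nonneg _))
  have e : zetaTrapezoid n s = -((n + 2 : ℝ) : ℂ) ^ (1 - s) - -((n + 1 : ℝ) : ℂ) ^ (1 - s)
      - (((n + 2 : ℝ) - (n + 1)) / 2) • ((s - 1) * ((n + 1 : ℝ) : ℂ) ^ (-s)
        + (s - 1) * ((n + 2 : ℝ) : ℂ) ^ (-s)) := by
    rw [show (((n + 2 : ℝ) - (n + 1)) / 2) = 1 / 2 by ring, Complex.real_smul, zetaTrapezoid]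
    push_cast
    ring
  rw [e]
  refine this.trans (le_of_eq ?_)
  ring

theorem sum_zetaTrapezoid (N : ℕ) (s : ℂ) :
    ∑ n ∈ Finset.range N, zetaTrapezoid n s = 1 - ((N + 1 : ℝ) : ℂ) ^ (1 - s)
      - (s - 1) * (∑ n ∈ Finset.range N, ((n + 1 : ℝ) : ℂ) ^ (-s)
        + (((N + 1 : ℝ) : ℂ) ^ (-s) - 1) / 2) := by
  induction N with
  | zero => simp
  | succ N ih =>
    rw [Finset.sum_range_succ, ih, Finset.sum_range_succ, zetaTrapezoid]
    push_cast
    rw [show (N : ℂ) + 1 + 1 = N + 2 by ring]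
    ring

theorem summable_add_one_rpow {p : ℝ} (hp : p < -1) : Summable fun n : ℕ => (n + 1 : ℝ) ^ p := by
  have := (summable_nat_add_iff 1).2 (Real.summable_nat_rpow.2 hp)
  simpa using this

theorem summable_zetaTrapezoid {s : ℂ} (hs : -1 < s.re) :
    Summable fun n => zetaTrapezoid n s :=
  Summable.of_norm_bounded ((summable_add_one_rpow (by linarith)).mul_left _)
    fun n => norm_zetaTrapezoid_le n hs

theorem differentiableOn_tsum_zetaTrapezoid :
    DifferentiableOn ℂ (fun s => ∑' n, zetaTrapezoid n s) {s | -1 < s.re} := by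
  intro s₀ hs₀
  simp only [Set.mem_ofPred_eq] at hs₀
  obtain ⟨c, hc1, hc2⟩ := exists_between hs₀
  let V : Set ℂ := {s | c < s.re} ∩ Metric.ball 0 (‖s₀‖ + 1)
  have hV : IsOpen V := (isOpen_lt continuous_const Complex.continuous_re).inter Metric.isOpen_ball
  have hmem : s₀ ∈ V := ⟨hc2, by simp⟩
  set R := ‖s₀‖ + 1
  have hR : 0 ≤ R := by positivity
  have : DifferentiableOn ℂ (fun s => ∑' n, zetaTrapezoid n s) V := by
    refine Complex.differentiableOn_tsum_of_summable_norm
      (u := fun n : ℕ => (R + 1) * R * (R + 1) * (n + 1 : ℝ) ^ (-c - 2))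
      ((summable_add_one_rpow (by linarith)).mul_left _)
      (fun n => (differentiable_zetaTrapezoid n).differentiableOn) hV ?_
    rintro n s ⟨h1, h2⟩
    replace h1 : c < s.re := h1
    have h2' : ‖s‖ ≤ R := by simpa using (Metric.mem_ball.1 h2).le
    refine (norm_zetaTrapezoid_le n (by linarith)).trans ?_
    rw [norm_mul, norm_mul]
    have h3 : ‖s - 1‖ ≤ R + 1 := (norm_sub_le _ _).trans (by simpa using h2')
    have h4 : ‖s + 1‖ ≤ R + 1 := (norm_add_le _ _).trans (by simpa using h2')
    have h5 : (1 : ℝ) ≤ n + 1 := by linarith [n.cast_nonneg (α := ℝ)]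
    gcongr
  exact (this.differentiableAt (hV.mem_nhds hmem)).differentiableWithinAt

/-- The entire function `(s - 1) ζ(s)`. -/
theorem differentiable_update_sub_one_mul_riemannZeta :
    Differentiable ℂ (Function.update (fun s : ℂ => (s - 1) * riemannZeta s) 1 1) := by
  rw [← differentiableOn_univ,
    ← Complex.differentiableOn_compl_singleton_and_continuousAt_iff (c := 1) Filter.univ_mem]
  refine ⟨DifferentiableOn.congr (f := fun s ↦ (s - 1) * riemannZeta s)
    (fun s hs ↦ DifferentiableAt.differentiableWithinAt ?_)
    fun _ hs ↦ Function.update_of_ne (Set.mem_sdiff_singleton.mp hs).2 ..,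
    continuousWithinAt_compl_self.mp ?_⟩
  · exact (by fun_prop : DifferentiableAt ℂ (fun s : ℂ => s - 1) s).mul
      (differentiableAt_riemannZeta (Set.mem_sdiff_singleton.mp hs).2)
  · simpa using riemannZeta_residue_one

theorem tsum_zetaTrapezoid_of_one_lt_re {s : ℂ} (hs : 1 < s.re) :
    ∑' n, zetaTrapezoid n s = 1 + (s - 1) / 2 - (s - 1) * riemannZeta s := by
  have h1 := (summable_zetaTrapezoid (s := s) (by linarith)).hasSum.tendsto_sum_nat
  have hz : Tendsto (fun N : ℕ => ∑ n ∈ Finset.range N, ((n + 1 : ℝ) : ℂ) ^ (-s)) atTop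
      (𝓝 (riemannZeta s)) := by
    rw [zeta_eq_tsum_one_div_nat_add_one_cpow hs]
    have hsum : Summable fun n : ℕ => 1 / (n + 1 : ℂ) ^ s := by
      have := (summable_nat_add_iff 1).2 (Complex.summable_one_div_nat_cpow.2 hs)
      simpa using this
    refine hsum.hasSum.tendsto_sum_nat.congr fun N => Finset.sum_congr rfl fun n _ => ?_
    rw [Complex.cpow_neg, one_div]
    push_cast
    rfl
  have hp : ∀ c : ℂ, c.re < 0 → Tendsto (fun N : ℕ => ((N + 1 : ℝ) : ℂ) ^ c) atTop (𝓝 0) := by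
    intro c hc
    rw [tendsto_zero_iff_norm_tendsto_zero]
    have e : ∀ N : ℕ, ‖((N + 1 : ℝ) : ℂ) ^ c‖ = (N + 1 : ℝ) ^ (-(-c.re)) := fun N => by
      rw [Complex.norm_cpow_eq_rpow_re_of_pos (by positivity), neg_neg]
    simp_rw [e]
    exact (tendsto_rpow_neg_atTop (by linarith)).comp
      (tendsto_atTop_add_const_right _ _ tendsto_natCast_atTop_atTop)
  have h2 := ((tendsto_const_nhds (x := (1 : ℂ))).sub (hp (1 - s) (by simp; linarith))).sub
    ((hz.add (((hp (-s) (by simp; linarith)).sub_const 1).div_const 2)).const_mul (s - 1))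
  refine (tendsto_nhds_unique h1 (h2.congr fun N => (sum_zetaTrapezoid N s).symm)).trans ?_
  ring

theorem tsum_zetaTrapezoid {s : ℂ} (hs : -1 < s.re) (hs1 : s ≠ 1) :
    ∑' n, zetaTrapezoid n s = 1 + (s - 1) / 2 - (s - 1) * riemannZeta s := by
  have hU : IsOpen {s : ℂ | -1 < s.re} := isOpen_lt continuous_const Complex.continuous_re
  have hconv : Convex ℝ {s : ℂ | -1 < s.re} := convex_halfSpace_re_gt (-1)
  have hf := differentiableOn_tsum_zetaTrapezoid.analyticOnNhd hU
  have hg : AnalyticOnNhd ℂ (fun s : ℂ => 1 + (s - 1) / 2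
      - Function.update (fun s : ℂ => (s - 1) * riemannZeta s) 1 1 s) {s : ℂ | -1 < s.re} := by
    refine DifferentiableOn.analyticOnNhd (Differentiable.differentiableOn ?_) hU
    exact (by fun_prop : Differentiable ℂ fun s : ℂ => 1 + (s - 1) / 2).sub
      differentiable_update_sub_one_mul_riemannZeta
  have hev : (fun s => ∑' n, zetaTrapezoid n s) =ᶠ[𝓝 2] (fun s : ℂ => 1 + (s - 1) / 2
      - Function.update (fun s : ℂ => (s - 1) * riemannZeta s) 1 1 s) := by
    have : {s : ℂ | 1 < s.re} ∈ 𝓝 (2 : ℂ) :=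
      (isOpen_lt continuous_const Complex.continuous_re).mem_nhds (by simp)
    filter_upwards [this] with z hz
    replace hz : 1 < z.re := hz
    have hz1 : z ≠ 1 := by rintro rfl; simp at hz
    rw [tsum_zetaTrapezoid_of_one_lt_re hz, Function.update_of_ne hz1]
  have := hf.eqOn_of_preconnected_of_eventuallyEq hg hconv.isPreconnected
    (z₀ := 2) (by simp; norm_num) hev hs
  simpa [Function.update_of_ne hs1] using this

theorem rpow_le_mul_rpow_sub_rpow {p t : ℝ} (hp : 1 < p) (ht : 1 ≤ t) :
    t ^ (-p) ≤ 2 ^ p / (p - 1) * (t ^ (1 - p) - (t + 1) ^ (1 - p)) := by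
  have ht0 : 0 < t := by linarith
  obtain ⟨c, hc, hc'⟩ := exists_hasDerivAt_eq_slope (fun u : ℝ => u ^ (1 - p))
    (fun u => (1 - p) * u ^ (1 - p - 1)) (by linarith : t < t + 1)
    (fun u hu => (Real.continuousAt_rpow_const _ _
      (Or.inl (by linarith [hu.1] : 0 < u).ne')).continuousWithinAt)
    (fun u hu => Real.hasDerivAt_rpow_const (Or.inl (by linarith [hu.1] : 0 < u).ne'))
  have h1 : (2 * t) ^ (-p) ≤ c ^ (-p) :=
    Real.rpow_le_rpow_of_nonpos (by linarith [hc.1]) (by linarith [hc.2]) (by linarith)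
  rw [Real.mul_rpow (by norm_num) ht0.le, Real.rpow_neg (by norm_num)] at h1
  rw [show t + 1 - t = 1 by ring, div_one, show 1 - p - 1 = -p by ring] at hc'
  have h2 : (0 : ℝ) < 2 ^ p := by positivity
  have h3 : 0 < p - 1 := by linarith
  have h4 : t ^ (1 - p) - (t + 1) ^ (1 - p) = (p - 1) * c ^ (-p) := by linarith
  rw [h4]
  calc t ^ (-p) = 2 ^ p * ((2 ^ p)⁻¹ * t ^ (-p)) := by field_simp
    _ ≤ 2 ^ p * c ^ (-p) := by gcongr
    _ = _ := by field_simp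

theorem norm_tsum_sub_sum_zetaTrapezoid_le {s : ℂ} (hs : -1 < s.re) :
    ∃ K : ℝ, 0 ≤ K ∧ ∀ N : ℕ, ‖∑' n, zetaTrapezoid n s - ∑ n ∈ Finset.range N, zetaTrapezoid n s‖
      ≤ K * (N + 1 : ℝ) ^ (-s.re - 1) := by
  set p := s.re + 2 with hp
  set A := ‖(s - 1) * s * (s + 1)‖
  set K := A * (2 ^ p / (p - 1)) with hK
  have hp1 : 0 < p - 1 := by linarith
  have hA : 0 ≤ A := norm_nonneg _
  have hK0 : 0 ≤ K := by positivity
  refine ⟨K, hK0, fun N => ?_⟩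
  have hpart : ∀ m : ℕ, ‖∑ n ∈ Finset.range (m + N), zetaTrapezoid n s
      - ∑ n ∈ Finset.range N, zetaTrapezoid n s‖
      ≤ K * ((N + 1 : ℝ) ^ (1 - p) - (m + N + 1 : ℝ) ^ (1 - p)) := by
    intro m
    induction m with
    | zero => simp
    | succ m ih =>
      rw [show m + 1 + N = m + N + 1 by ring, Finset.sum_range_succ, add_sub_right_comm]
      refine (norm_add_le _ _).trans ?_
      have h1 := norm_zetaTrapezoid_le (m + N) hs
      have h2 := rpow_le_mul_rpow_sub_rpow (p := p) (t := (m + N : ℕ) + 1) (by linarith)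
        (by linarith [(m + N).cast_nonneg (α := ℝ)])
      rw [show -s.re - 2 = -p by rw [hp]; ring] at h1
      have h3 := h1.trans (mul_le_mul_of_nonneg_left h2 hA)
      rw [← mul_assoc, ← hK] at h3
      push_cast at h3 ⊢
      rw [show (m + 1 + N + 1 : ℝ) = m + N + 1 + 1 by ring]
      linarith
  have hlim := ((tendsto_add_atTop_iff_nat N).2
    (summable_zetaTrapezoid hs).hasSum.tendsto_sum_nat).sub_const
      (∑ n ∈ Finset.range N, zetaTrapezoid n s)
  refine le_of_tendsto hlim.norm (Eventually.of_forall fun m => (hpart m).trans ?_)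
  rw [show -s.re - 1 = 1 - p by rw [hp]; ring]
  have : (0 : ℝ) ≤ (m + N + 1 : ℝ) ^ (1 - p) := by positivity
  gcongr
  linarith

/-- First terms of the Euler-Maclaurin expansion of `∑ k ^ (-s)` for `-1 < s < 1`. -/
theorem abs_sum_rpow_sub_zeta_le {s : ℝ} (hs : -1 < s) (hs1 : s < 1) :
    ∃ K : ℝ, 0 ≤ K ∧ ∀ n : ℕ, 1 ≤ n →
      |(∑ k ∈ Finset.Icc 1 (n - 1), (k : ℝ) ^ (-s)) - (n : ℝ) ^ (1 - s) / (1 - s)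
        - (riemannZeta s).re + (n : ℝ) ^ (-s) / 2| ≤ K * (n : ℝ) ^ (-s - 1) := by
  obtain ⟨K, hK, h⟩ := norm_tsum_sub_sum_zetaTrapezoid_le (s := (s : ℂ)) (by simpa using hs)
  have hpos : 0 < 1 - s := by linarith
  refine ⟨K / (1 - s), by positivity, fun n hn => ?_⟩
  obtain ⟨N, rfl⟩ := Nat.exists_eq_add_of_le' hn
  have h := h N
  rw [tsum_zetaTrapezoid (by simpa using hs) (by exact_mod_cast hs1.ne), sum_zetaTrapezoid] at h
  have hc : ∀ (n : ℕ) (c : ℝ), ((n + 1 : ℝ) : ℂ) ^ (c : ℂ) = (((n + 1 : ℝ) ^ c : ℝ) : ℂ) :=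
    fun n c => (Complex.ofReal_cpow (by positivity) c).symm
  have h' := (Complex.abs_re_le_norm _).trans h
  rw [show (1 - (s : ℂ)) = ((1 - s : ℝ) : ℂ) by push_cast; ring,
    show (-(s : ℂ)) = ((-s : ℝ) : ℂ) by push_cast; ring, hc, hc] at h'
  simp_rw [hc] at h'
  rw [show ((s : ℂ) - 1) = ((s - 1 : ℝ) : ℂ) by push_cast; ring, ← Complex.ofReal_sum] at h'
  have hsum : ∑ k ∈ Finset.Icc 1 (N + 1 - 1), (k : ℝ) ^ (-s)
      = ∑ n ∈ Finset.range N, (n + 1 : ℝ) ^ (-s) := by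
    rw [Nat.add_sub_cancel]
    clear h h' hn
    induction N with
    | zero => simp
    | succ N ih => rw [Finset.sum_Icc_succ_top (by lia), ih, Finset.sum_range_succ]; push_cast; rfl
  rw [hsum]
  set S := ∑ n ∈ Finset.range N, (n + 1 : ℝ) ^ (-s)
  push_cast
  set P := (N + 1 : ℝ) ^ (1 - s)
  set Q := (N + 1 : ℝ) ^ (-s)
  have e : (1 + ((s - 1 : ℝ) : ℂ) / 2 - ((s - 1 : ℝ) : ℂ) * riemannZeta s - (1 - (P : ℂ)
      - ((s - 1 : ℝ) : ℂ) * ((S : ℂ) + ((Q : ℂ) - 1) / 2))).re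
      = -((1 - s) * (S - P / (1 - s) - (riemannZeta s).re + Q / 2)) := by
    have : (1 - s) * (S - P / (1 - s) - (riemannZeta s).re + Q / 2)
      = (1 - s) * (S  - (riemannZeta s).re + Q / 2) - P := by field_simp; ring
    rw [this]
    simp
    ring
  rw [e, abs_neg, abs_mul, abs_of_pos hpos, Complex.ofReal_re] at h'
  rw [div_mul_eq_mul_div, le_div_iff₀ hpos]
  linarith

theorem abs_taylor_one_le {f f' f'' : ℝ → ℝ} (h1 : ∀ t, HasDerivAt f (f' t) t)
    (h2 : ∀ t, HasDerivAt f' (f'' t) t) {S : Set ℝ} (hS : S.OrdConnected) {M : ℝ}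
    (hM : ∀ t ∈ S, |f'' t| ≤ M) {u v : ℝ} (hu : u ∈ S) (hv : v ∈ S) :
    |f u - f v - f' v * (u - v)| ≤ M * |u - v| ^ 2 := by
  have hM0 : 0 ≤ M := (abs_nonneg _).trans (hM u hu)
  have hsub : Set.uIcc v u ⊆ S := hS.uIcc_subset hv hu
  have hconv : Convex ℝ (Set.uIcc v u) := convex_uIcc v u
  have hdist : ∀ t ∈ Set.uIcc v u, |t - v| ≤ |u - v| := fun t ht =>
    Set.abs_sub_left_of_mem_uIcc ht
  have b1 : ∀ t ∈ Set.uIcc v u, ‖f' t - f' v‖ ≤ M * |u - v| := fun t ht =>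
    (hconv.norm_image_sub_le_of_norm_hasDerivWithin_le (fun w _ => (h2 w).hasDerivWithinAt)
      (fun w hw => hM w (hsub hw)) Set.left_mem_uIcc ht).trans
      (mul_le_mul_of_nonneg_left (hdist t ht) hM0)
  have b2 := hconv.norm_image_sub_le_of_norm_hasDerivWithin_le
    (f := fun t => f t - f' v * t) (f' := fun t => f' t - f' v)
    (fun w _ => ((h1 w).sub (by simpa using (hasDerivAt_id w).const_mul (f' v))).hasDerivWithinAt)
    b1 Set.left_mem_uIcc Set.right_mem_uIcc
  simp only [Real.norm_eq_abs] at b2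
  calc |f u - f v - f' v * (u - v)| = |f u - f' v * u - (f v - f' v * v)| := by congr 1; ring
    _ ≤ _ := b2
    _ = _ := by ring

theorem abs_taylor_two_le {f f' f'' f''' : ℝ → ℝ} (h1 : ∀ t, HasDerivAt f (f' t) t)
    (h2 : ∀ t, HasDerivAt f' (f'' t) t) (h3 : ∀ t, HasDerivAt f'' (f''' t) t)
    {S : Set ℝ} (hS : S.OrdConnected) {M : ℝ}
    (hM : ∀ t ∈ S, |f''' t| ≤ M) {u v : ℝ} (hu : u ∈ S) (hv : v ∈ S) :
    |f u - f v - f' v * (u - v) - f'' v / 2 * (u - v) ^ 2| ≤ M * |u - v| ^ 3 := by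
  have hM0 : 0 ≤ M := (abs_nonneg _).trans (hM u hu)
  have hsub : Set.uIcc v u ⊆ S := hS.uIcc_subset hv hu
  have b1 : ∀ t ∈ Set.uIcc v u, ‖f' t - f' v - f'' v * (t - v)‖ ≤ M * |u - v| ^ 2 := fun t ht =>
    (abs_taylor_one_le h2 h3 hS hM (hsub ht) hv).trans (by
      have := Set.abs_sub_left_of_mem_uIcc ht
      gcongr)
  have b2 := (convex_uIcc v u).norm_image_sub_le_of_norm_hasDerivWithin_le
    (f := fun t => f t - f' v * t - f'' v / 2 * (t - v) ^ 2)
    (f' := fun t => f' t - f' v - f'' v * (t - v))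
    (fun w _ => by
      refine HasDerivAt.hasDerivWithinAt ?_
      have := ((h1 w).sub ((hasDerivAt_id w).const_mul (f' v))).sub
        ((((hasDerivAt_id w).sub_const v).pow 2).const_mul (f'' v / 2))
      convert! this using 1
      simp
      ring)
    b1 Set.left_mem_uIcc Set.right_mem_uIcc
  simp only [Real.norm_eq_abs] at b2
  calc _ = |f u - f' v * u - f'' v / 2 * (u - v) ^ 2
        - (f v - f' v * v - f'' v / 2 * (v - v) ^ 2)| := by congr 1; ring
    _ ≤ _ := b2
    _ = _ := by ring

/-- Trapezoidal rule for `t ^ (-α) * r t` when `r` vanishes to second order at the singularity. -/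
theorem abs_trapezoid_rpow_mul_le {α x M : ℝ} (hα0 : 0 < α) (hα1 : α < 1)
    {r r' r'' : ℝ → ℝ} (hr : ∀ t, HasDerivAt r (r' t) t) (hr' : ∀ t, HasDerivAt r' (r'' t) t)
    (b0 : ∀ t ∈ Set.Icc 0 x, |r t| ≤ M * t ^ 2) (b1 : ∀ t ∈ Set.Icc 0 x, |r' t| ≤ M * t)
    (b2 : ∀ t ∈ Set.Icc 0 x, |r'' t| ≤ M) {h : ℝ} (hh : 0 < h) (j : ℕ)
    (hj : (j + 1 : ℝ) * h ≤ x) :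
    |h * (∑ k ∈ Finset.Icc 1 j, (k * h) ^ (-α) * r (k * h))
        + h / 2 * (((j + 1 : ℝ) * h) ^ (-α) * r ((j + 1) * h))
        - ∫ t in (0 : ℝ)..((j + 1) * h), t ^ (-α) * r t|
      ≤ 2 * M * (h ^ 3 * h ^ (-α))
        + 5 * M * (h ^ 3 * h ^ (-α)) * ∑ k ∈ Finset.Icc 1 j, (k : ℝ) ^ (-α) := by
  have hrc : Continuous r := continuous_iff_continuousAt.2 fun t => (hr t).continuousAt
  have hint : ∀ a b : ℝ, IntervalIntegrable (fun t => t ^ (-α) * r t) MeasureTheory.volume a b :=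
    fun a b => (intervalIntegral.intervalIntegrable_rpow' (by linarith)).mul_continuousOn
      hrc.continuousOn
  have hbF : ∀ t, 0 < t → t ≤ x → |t ^ (-α) * r t| ≤ M * (t ^ 2 * t ^ (-α)) := fun t ht htx => by
    rw [abs_mul, abs_of_pos (by positivity : 0 < t ^ (-α))]
    calc _ ≤ t ^ (-α) * (M * t ^ 2) := by gcongr; exact b0 t ⟨ht.le, htx⟩
      _ = _ := by ring
  induction j with
  | zero =>
    have hhx : h ≤ x := by simpa using hj
    have hM : 0 ≤ M := (abs_nonneg _).trans (b2 h ⟨hh.le, hhx⟩)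
    have e1 : ‖∫ t in (0 : ℝ)..h, t ^ (-α) * r t‖ ≤ M * (h ^ 2 * h ^ (-α)) * |h - 0| := by
      refine intervalIntegral.norm_integral_le_of_norm_le_const fun t ht => ?_
      rw [Set.uIoc_of_le hh.le] at ht
      refine (hbF t ht.1 (ht.2.trans hhx)).trans (mul_le_mul_of_nonneg_left ?_ hM)
      have e : ∀ s : ℝ, 0 < s → s ^ 2 * s ^ (-α) = s ^ (2 - α) := fun s hs => by
        rw [← Real.rpow_natCast, ← Real.rpow_add hs]; congr 1
      rw [e t ht.1, e h hh]
      exact Real.rpow_le_rpow ht.1.le ht.2 (by linarith)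
    have e2 := hbF h hh hhx
    rw [sub_zero, abs_of_pos hh, Real.norm_eq_abs] at e1
    simp only [CharP.cast_eq_zero, zero_add, one_mul, Finset.Icc_eq_empty_of_lt zero_lt_one,
      Finset.sum_empty, mul_zero, add_zero]
    refine (abs_sub _ _).trans ?_
    rw [abs_mul, abs_of_pos (by positivity : 0 < h / 2)]
    have : h / 2 * |h ^ (-α) * r h| ≤ h / 2 * (M * (h ^ 2 * h ^ (-α))) := by gcongr
    have h0 : 0 ≤ M * (h ^ 3 * h ^ (-α)) := by positivity
    nlinarith
  | succ j ih =>
    have hj' : ((j + 1 : ℝ) + 1) * h ≤ x := by push_cast at hj; exact hj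
    have hjh : ((j + 1 : ℝ) + 1) * h = (j + 1) * h + h := by ring
    have ih := ih (by linarith)
    set a := (j + 1 : ℝ) * h with ha
    have ha0 : 0 < a := by positivity
    have hab : a ≤ a + h := by linarith
    have hpos : ∀ t ∈ Set.Icc a (a + h), 0 < t := fun t ht => ha0.trans_le ht.1
    have hM : 0 ≤ M := (abs_nonneg _).trans (b2 a ⟨ha0.le, by linarith⟩)
    have hp : ∀ (c t : ℝ), 0 < t → HasDerivAt (fun u : ℝ => u ^ c) (c * t ^ (c - 1)) t :=
      fun c t ht => Real.hasDerivAt_rpow_const (Or.inl ht.ne')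
    have key := norm_trapezoid_error_le (a := a) (b := a + h)
      (Φ := fun t => ∫ s in (0 : ℝ)..t, s ^ (-α) * r s)
      (F := fun t => t ^ (-α) * r t)
      (F' := fun t => -α * t ^ (-α - 1) * r t + t ^ (-α) * r' t)
      (F'' := fun t => (-α * ((-α - 1) * t ^ (-α - 1 - 1)) * r t + -α * t ^ (-α - 1) * r' t)
        + (-α * t ^ (-α - 1) * r' t + t ^ (-α) * r'' t))
      (M := 5 * M * a ^ (-α)) hab
      (fun t ht => by
        have hc : ContinuousOn (fun t => t ^ (-α) * r t) (Set.Ioi 0) := fun u hu =>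
          ((Real.continuousAt_rpow_const _ _ (Or.inl (ne_of_gt hu))).mul
            hrc.continuousAt).continuousWithinAt
        have ht0 : t ∈ Set.Ioi (0 : ℝ) := hpos t ht
        exact intervalIntegral.integral_hasDerivAt_right (hint _ _)
          (hc.stronglyMeasurableAtFilter isOpen_Ioi t ht0) (hc.continuousAt (isOpen_Ioi.mem_nhds ht0)))
      (fun t ht => (hp (-α) t (hpos t ht)).mul (hr t))
      (fun t ht => (((hp (-α - 1) t (hpos t ht)).const_mul (-α)).mul (hr t)).add
        ((hp (-α) t (hpos t ht)).mul (hr' t)))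
      (fun t ht => by
        have t0 := hpos t ht
        have htx : t ∈ Set.Icc 0 x := ⟨t0.le, by linarith [ht.2]⟩
        have p1 : t ^ (-α - 1) = t ^ (-α) / t := Real.rpow_sub_one t0.ne' _
        have p2 : t ^ (-α - 1 - 1) = t ^ (-α) / t / t := by
          rw [Real.rpow_sub_one t0.ne', p1]
        set T := t ^ (-α) with hT
        have hT0 : 0 < T := by positivity
        have hTa : T ≤ a ^ (-α) := Real.rpow_le_rpow_of_nonpos ha0 ht.1 (by linarith)
        have q0 : |r t / t / t| ≤ M := by
          rw [abs_div, abs_div, abs_of_pos t0, div_div, div_le_iff₀ (by positivity)]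
          linarith [b0 t htx]
        have q1 : |r' t / t| ≤ M := by
          rw [abs_div, abs_of_pos t0, div_le_iff₀ t0]
          exact b1 t htx
        have q2 := b2 t htx
        rw [p1, p2, Real.norm_eq_abs, show (-α * ((-α - 1) * (T / t / t)) * r t + -α * (T / t) * r' t)
          + (-α * (T / t) * r' t + T * r'' t)
          = T * (α * (α + 1) * (r t / t / t) - 2 * α * (r' t / t) + r'' t) by ring,
          abs_mul, abs_of_pos hT0]
        have : |α * (α + 1) * (r t / t / t) - 2 * α * (r' t / t) + r'' t| ≤ 5 * M := by
          refine (abs_add_le _ _).trans ?_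
          have c0 : |α * (α + 1) * (r t / t / t)| ≤ 2 * M := by
            rw [abs_mul, abs_of_pos (by positivity : 0 < α * (α + 1))]
            exact mul_le_mul (by nlinarith) q0 (abs_nonneg _) (by norm_num)
          have c1 : |2 * α * (r' t / t)| ≤ 2 * M := by
            rw [abs_mul, abs_of_pos (by positivity : 0 < 2 * α)]
            exact mul_le_mul (by linarith) q1 (abs_nonneg _) (by norm_num)
          linarith [abs_sub (α * (α + 1) * (r t / t / t)) (2 * α * (r' t / t))]
        calc _ ≤ a ^ (-α) * (5 * M) := by gcongr
          _ = _ := by ring)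
    rw [Finset.sum_Icc_succ_top (by lia), Finset.sum_Icc_succ_top (by lia)]
    push_cast
    rw [hjh, ← ha]
    have ea : a ^ (-α) = (j + 1 : ℝ) ^ (-α) * h ^ (-α) := Real.mul_rpow (by positivity) hh.le
    rw [show a + h - a = h by ring, Real.norm_eq_abs, smul_eq_mul] at key
    rw [show 5 * M * a ^ (-α) * h ^ 3 = 5 * M * (h ^ 3 * h ^ (-α)) * (j + 1 : ℝ) ^ (-α) by
      rw [ea]; ring] at key
    rw [abs_le] at key ih ⊢
    constructor <;> linarith only [key.1, key.2, ih.1, ih.2]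

theorem sum_centered_difference (w f : ℝ → ℝ) (m : ℕ) :
    ∑ k ∈ Finset.Icc 1 (m + 4), w k * (f (k - 1) - f (k + 1))
      = w 1 * f 0 + w 2 * f 1 + (w 3 - w 1) * f 2
        + ∑ k ∈ Finset.Icc 3 (m + 3), (w (k + 1) - w (k - 1)) * f k
        - w (m + 3) * f (m + 4) - w (m + 4) * f (m + 5) := by
  induction m with
  | zero =>
    simp [Finset.sum_Icc_succ_top]
    norm_num
    ring
  | succ m ih =>
    have h1 := Finset.sum_Icc_succ_top (show 1 ≤ m + 4 + 1 by lia)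
      fun k : ℕ => w k * (f (k - 1) - f (k + 1))
    have h2 := Finset.sum_Icc_succ_top (show 3 ≤ m + 3 + 1 by lia)
      fun k : ℕ => (w (k + 1) - w (k - 1)) * f k
    rw [show m + 1 + 4 = m + 4 + 1 by ring, show m + 1 + 3 = m + 3 + 1 by ring, h1, h2, ih]
    push_cast
    ring_nf

theorem integral_caputo_kernel {α x : ℝ} (hα1 : α < 1) (hx : 0 < x)
    {g r : ℝ → ℝ} {a b : ℝ} (hr : Continuous r) (hg : ∀ s, g (x - s) = a + b * s + r s) :
    ∫ t in (0 : ℝ)..x, g t / (x - t) ^ α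
      = a * (x ^ (1 - α) / (1 - α)) + b * (x ^ (2 - α) / (2 - α))
        + ∫ s in (0 : ℝ)..x, s ^ (-α) * r s := by
  have h1 : ∫ t in (0 : ℝ)..x, g t / (x - t) ^ α
      = ∫ s in (0 : ℝ)..x, g (x - s) / s ^ α := by
    have := intervalIntegral.integral_comp_sub_left (a := 0) (b := x)
      (fun s => g (x - s) / s ^ α) x
    simpa using this
  have h2 : ∫ s in (0 : ℝ)..x, g (x - s) / s ^ α
      = ∫ s in (0 : ℝ)..x, (a * s ^ (-α) + b * s ^ (1 - α) + s ^ (-α) * r s) := by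
    refine intervalIntegral.integral_congr fun s hs => ?_
    rw [Set.uIcc_of_le hx.le] at hs
    have : s ^ (1 - α) = s ^ (-α) * s := by
      rw [show 1 - α = -α + 1 by ring, Real.rpow_add_one' hs.1 (by linarith)]
    simp only [hg, div_eq_mul_inv, ← Real.rpow_neg hs.1, this]
    ring
  have i1 := (intervalIntegral.intervalIntegrable_rpow' (a := 0) (b := x)
    (by linarith : -1 < -α))
  have i2 := (intervalIntegral.intervalIntegrable_rpow' (a := 0) (b := x)
    (by linarith : -1 < 1 - α))
  rw [h1, h2, intervalIntegral.integral_add ((i1.const_mul a).add (i2.const_mul b))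
    (i1.mul_continuousOn hr.continuousOn),
    intervalIntegral.integral_add (i1.const_mul a) (i2.const_mul b),
    intervalIntegral.integral_const_mul, intervalIntegral.integral_const_mul,
    integral_rpow (Or.inl (by linarith)), integral_rpow (Or.inl (by linarith)),
    Real.zero_rpow (by linarith), Real.zero_rpow (by linarith)]
  ring_nf

set_option maxHeartbeats 2000000 in
theorem approx_second_order
    (α x : ℝ) (hα0 : 0 < α) (hα1 : α < 1) (hx : 0 < x)
    (y : ℝ → ℝ) (hy : ContDiff ℝ (⊤ : ℕ∞) y) (hy'0 : deriv y 0 = 0) :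
    ∃ C > 0, ∀ n : ℕ, 5 ≤ n →
      |(1 / (2 * Real.Gamma (1 - α) * (x / n) ^ α)) *
          ((1 - 3 * zr α + 2 * zr (α - 1)) * y x
            + ((2:ℝ) ^ (-α) + 4 * zr α - 4 * zr (α - 1)) * y (x - x / n)
            + ((3:ℝ) ^ (-α) - 1 - zr α + 2 * zr (α - 1)) * y (x - 2 * (x / n))
            + (∑ k ∈ Finset.Icc 3 (n - 2),
                (((k:ℝ) + 1) ^ (-α) - ((k:ℝ) - 1) ^ (-α)) * y (x - (k:ℝ) * (x / n)))
            + (-(((n:ℝ) - 2) ^ (-α)) - 2 * W n α) * y (x - ((n:ℝ) - 1) * (x / n))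
            + (-(((n:ℝ) - 1) ^ (-α)) + 2 * W n α) * y (x - (n:ℝ) * (x / n)))
        - caputo α y x|
      ≤ C * (x / n) ^ 2 := by
  set y1 := deriv y with hy1
  set y2 := deriv y1 with hy2
  set y3 := deriv y2 with hy3
  have c1 : ContDiff ℝ (⊤ : ℕ∞) y1 := (contDiff_infty_iff_deriv.1 hy).2
  have c2 : ContDiff ℝ (⊤ : ℕ∞) y2 := (contDiff_infty_iff_deriv.1 c1).2
  have c3 : ContDiff ℝ (⊤ : ℕ∞) y3 := (contDiff_infty_iff_deriv.1 c2).2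
  have d1 : ∀ t, HasDerivAt y (y1 t) t := fun t =>
    ((contDiff_infty_iff_deriv.1 hy).1 t).hasDerivAt
  have d2 : ∀ t, HasDerivAt y1 (y2 t) t := fun t =>
    ((contDiff_infty_iff_deriv.1 c1).1 t).hasDerivAt
  have d3 : ∀ t, HasDerivAt y2 (y3 t) t := fun t =>
    ((contDiff_infty_iff_deriv.1 c2).1 t).hasDerivAt
  obtain ⟨M, hM0, hM2, hM3⟩ : ∃ M : ℝ, 0 ≤ M ∧ (∀ t ∈ Set.Icc 0 x, |y2 t| ≤ M) ∧
      ∀ t ∈ Set.Icc 0 x, |y3 t| ≤ M := by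
    obtain ⟨A, hA⟩ := isCompact_Icc.exists_bound_of_continuousOn
      (s := Set.Icc 0 x) c2.continuous.continuousOn
    obtain ⟨B, hB⟩ := isCompact_Icc.exists_bound_of_continuousOn
      (s := Set.Icc 0 x) c3.continuous.continuousOn
    exact ⟨max 0 (max A B), le_max_left _ _,
      fun t ht => (hA t ht).trans ((le_max_left _ _).trans (le_max_right _ _)),
      fun t ht => (hB t ht).trans ((le_max_right _ _).trans (le_max_right _ _))⟩
  have hS : (Set.Icc 0 x).OrdConnected := Set.ordConnected_Icc
  have hx0 : x ∈ Set.Icc 0 x := ⟨hx.le, le_rfl⟩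
  have h00 : (0 : ℝ) ∈ Set.Icc 0 x := ⟨le_rfl, hx.le⟩
  have T1 := fun u hu v hv => abs_taylor_one_le (u := u) (v := v) d1 d2 hS hM2 hu hv
  have T2 := fun u hu v hv => abs_taylor_two_le (u := u) (v := v) d1 d2 d3 hS hM3 hu hv
  set r : ℝ → ℝ := fun s => y1 (x - s) - y1 x + y2 x * s with hrdef
  have hr : ∀ t, HasDerivAt r (-y2 (x - t) + y2 x) t := fun t => by
    have := (((d2 (x - t)).comp_const_sub x t).sub_const (y1 x)).add
      ((hasDerivAt_id t).const_mul (y2 x))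
    convert! this using 1
    simp
  have hr' : ∀ t, HasDerivAt (fun t => -y2 (x - t) + y2 x) (y3 (x - t)) t := fun t => by
    have := (((d3 (x - t)).comp_const_sub x t).neg).add_const (y2 x)
    simpa using this
  have hrc : Continuous r := continuous_iff_continuousAt.2 fun t => (hr t).continuousAt
  have hrefl : ∀ t ∈ Set.Icc 0 x, x - t ∈ Set.Icc 0 x := fun t ht =>
    ⟨by linarith [ht.2], by linarith [ht.1]⟩
  have b0 : ∀ t ∈ Set.Icc 0 x, |r t| ≤ M * t ^ 2 := fun t ht => by
    have := abs_taylor_one_le d2 d3 hS hM3 (hrefl t ht) hx0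
    rw [show x - t - x = -t by ring, abs_neg, sq_abs] at this
    refine le_trans (le_of_eq ?_) this
    congr 1
    ring
  have b2 : ∀ t ∈ Set.Icc 0 x, |y3 (x - t)| ≤ M := fun t ht => hM3 _ (hrefl t ht)
  have b1 : ∀ t ∈ Set.Icc 0 x, |-y2 (x - t) + y2 x| ≤ M * t := fun t ht => by
    have := (convex_Icc 0 x).norm_image_sub_le_of_norm_hasDerivWithin_le
      (fun w _ => (d3 w).hasDerivWithinAt) hM3 (hrefl t ht) hx0
    rw [Real.norm_eq_abs, Real.norm_eq_abs, show x - (x - t) = t by ring, abs_of_nonneg ht.1] at this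
    rwa [neg_add_eq_sub]
  obtain ⟨K0, hK0, hE0⟩ := abs_sum_rpow_sub_zeta_le (s := α) (by linarith) hα1
  obtain ⟨K1, hK1, hE1⟩ := abs_sum_rpow_sub_zeta_le (s := α - 1) (by linarith) (by linarith)
  set Z0 := zr α with hZ0
  set Z1 := zr (α - 1) with hZ1
  set X := x ^ (-α) with hX
  have hX0 : 0 < X := by positivity
  have hΓ : 0 < Real.Gamma (1 - α) := Real.Gamma_pos_of_pos (by linarith)
  set B := 1 / (1 - α) + |Z0| + K0 + 1 with hB
  have hB0 : 0 ≤ B := by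
    have : 0 < 1 - α := by linarith
    positivity
  set D := M * (B * (x * X)) + 6 * |Z0| * M * (x * X) + 10 * |Z1| * M * (x * X)
    + (K0 + 1) * M * X + |y1 x| * K0 * (X / x) + |y2 x| * K1 * X
    + (2 * M * (x * X) + 5 * M * (B * (x * X))) with hD
  have hD0 : 0 ≤ D := by positivity
  refine ⟨(1 / Real.Gamma (1 - α)) * D + 1, by positivity, fun n hn => ?_⟩
  obtain ⟨m, rfl⟩ := Nat.exists_eq_add_of_le' hn
  have hE0 := hE0 (m + 5) (by lia)
  have hE1 := hE1 (m + 5) (by lia)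
  have hcast : ((m + 5 : ℕ) : ℝ) = (m : ℝ) + 5 := by push_cast; rfl
  have hW : W (m + 5) α = (∑ k ∈ Finset.Icc 1 (m + 4), (k : ℝ) ^ (-α))
    - ((m + 5 : ℕ) : ℝ) ^ (1 - α) / (1 - α) - Z0 := rfl
  rw [hcast] at hE0 hE1 hW ⊢
  rw [show m + 5 - 1 = m + 4 by lia] at hE0 hE1
  rw [show m + 5 - 2 = m + 3 by lia]
  have hab := sum_centered_difference (fun u => u ^ (-α)) (fun u => y (x - u * (x / (m + 5)))) m
  set ν := (m : ℝ) + 5 with hν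
  have hν5 : 5 ≤ ν := by linarith [m.cast_nonneg (α := ℝ)]
  have hν0 : 0 < ν := by linarith only [hν5]
  have hν1 : 1 ≤ ν := by linarith only [hν5]
  set h := x / ν with hh
  have hh0 : 0 < h := by positivity
  have hνh : ν * h = x := by rw [hh]; field_simp
  have hhx : 5 * h ≤ x := by rw [← hνh]; gcongr
  set H := h ^ (-α) with hH
  set N := ν ^ (-α) with hN
  have hH0 : 0 < H := by positivity
  have hN0 : 0 < N := by positivity
  have hHN : N * H = X := by rw [hX, ← hνh, Real.mul_rpow hν0.le hh0.le]
  have pw : ∀ t : ℝ, 0 < t → t ^ (1 - α) = t * t ^ (-α) := fun t ht => by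
    rw [show 1 - α = -α + 1 by ring, Real.rpow_add_one ht.ne']; ring
  have pw2 : ∀ t : ℝ, 0 < t → t ^ (2 - α) = t ^ 2 * t ^ (-α) := fun t ht => by
    rw [show 2 - α = 1 - α + 1 by ring, Real.rpow_add_one ht.ne', pw t ht]; ring
  have hHx : h * H ≤ x * X := by
    rw [hX, hH, ← pw h hh0, ← pw x hx]
    exact Real.rpow_le_rpow hh0.le (by linarith) (by linarith)
  set σ0 := ∑ k ∈ Finset.Icc 1 (m + 4), (k : ℝ) ^ (-α) with hσ0
  set σ1 := ∑ k ∈ Finset.Icc 1 (m + 4), (k : ℝ) ^ (-(α - 1)) with hσ1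
  have hσ0' : 0 ≤ σ0 := Finset.sum_nonneg fun k _ => by positivity
  rw [pw ν hν0, Real.rpow_sub_one hν0.ne', ← hN] at hE0
  rw [show 1 - (α - 1) = 2 - α by ring, show -(α - 1) - 1 = -α by ring,
    show -(α - 1) = 1 - α by ring, pw2 ν hν0, pw ν hν0, ← hN] at hE1
  rw [pw ν hν0, ← hN] at hW
  change |σ0 - ν * N / (1 - α) - Z0 + N / 2| ≤ _ at hE0
  change |σ1 - ν ^ 2 * N / (2 - α) - (riemannZeta ((α - 1 : ℝ) : ℂ)).re + ν * N / 2| ≤ _ at hE1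
  have hZ1' : (riemannZeta ((α - 1 : ℝ) : ℂ)).re = Z1 := rfl
  rw [hZ1'] at hE1
  set E0 := σ0 - ν * N / (1 - α) - Z0 + N / 2 with hE0d
  set E1 := σ1 - ν ^ 2 * N / (2 - α) - Z1 + ν * N / 2 with hE1d
  have hnode : ∀ u : ℝ, 0 ≤ u → u ≤ ν → x - u * h ∈ Set.Icc 0 x := fun u h1 h2 =>
    ⟨by rw [← hνh]; nlinarith, by nlinarith⟩
  have hkb : ∀ k ∈ Finset.Icc 1 (m + 4), (1 : ℝ) ≤ k ∧ (k : ℝ) ≤ ν - 1 := fun k hk => by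
    rw [Finset.mem_Icc] at hk
    have h2 : (k : ℝ) ≤ ((m + 4 : ℕ) : ℝ) := by exact_mod_cast hk.2
    push_cast at h2
    exact ⟨by exact_mod_cast hk.1, by linarith⟩
  set G := ∑ k ∈ Finset.Icc 1 (m + 4), (k : ℝ) ^ (-α) * y1 (x - k * h) with hG
  set R := ∑ k ∈ Finset.Icc 1 (m + 4), (k : ℝ) ^ (-α) * r (k * h) with hR
  have hGR : G = y1 x * σ0 - y2 x * h * σ1 + R := by
    rw [hG, hR, hσ0, hσ1, Finset.mul_sum, Finset.mul_sum, ← Finset.sum_sub_distrib,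
      ← Finset.sum_add_distrib]
    refine Finset.sum_congr rfl fun k hk => ?_
    have hk0 : (0 : ℝ) < k := by linarith [(hkb k hk).1]
    rw [show -(α - 1) = 1 - α by ring, pw k hk0, hrdef]
    ring
  have hem := abs_trapezoid_rpow_mul_le (x := x) (M := M) hα0 hα1 hr hr' b0 b1 b2 hh0 (m + 4)
    (by push_cast; rw [show (m : ℝ) + 4 + 1 = ν by rw [hν]; ring, hνh])
  have hcast4 : ((m + 4 : ℕ) : ℝ) + 1 = ν := by push_cast; rw [hν]; ring
  have hrx : r x = -y1 x + y2 x * x := by simp [hrdef, hy'0]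
  have hsumR : ∑ k ∈ Finset.Icc 1 (m + 4), (k * h) ^ (-α) * r (k * h) = H * R := by
    rw [hR, Finset.mul_sum]
    refine Finset.sum_congr rfl fun k _ => ?_
    rw [Real.mul_rpow k.cast_nonneg hh0.le]
    ring
  rw [hcast4, hνh, hsumR, hrx, ← hX, ← hH, ← hσ0] at hem
  have hcap := integral_caputo_kernel (g := y1) (a := y1 x) (b := -y2 x) hα1 hx hrc
    (fun s => by simp only [hrdef]; ring)
  set IF := ∫ s in (0 : ℝ)..x, s ^ (-α) * r s with hIF
  rw [pw x hx, pw2 x hx, ← hX] at hcap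
  have hcap' : caputo α y x = 1 / Real.Gamma (1 - α) *
      (y1 x * (x * X / (1 - α)) + -y2 x * (x ^ 2 * X / (2 - α)) + IF) := by
    rw [caputo, ← hcap]
  have hhα : 1 / (2 * Real.Gamma (1 - α) * h ^ α) = 1 / Real.Gamma (1 - α) * (H / 2) := by
    rw [hH, Real.rpow_neg hh0.le]
    field_simp
  set f : ℝ → ℝ := fun u => y (x - u * h) with hf
  set S0 := ∑ k ∈ Finset.Icc 1 (m + 4), (k : ℝ) ^ (-α) * (f (k - 1) - f (k + 1)) with hS0
  have he1 : |S0 - 2 * h * G| ≤ 2 * M * h ^ 3 * σ0 := by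
    rw [hS0, hG, hσ0, Finset.mul_sum, ← Finset.sum_sub_distrib, Finset.mul_sum]
    refine (Finset.abs_sum_le_sum_abs _ _).trans (Finset.sum_le_sum fun k hk => ?_)
    obtain ⟨hk1, hk2⟩ := hkb k hk
    have t1 := T2 (x - (k - 1) * h) (hnode _ (by linarith only [hk1, hk2]) (by linarith only [hk1, hk2])) (x - k * h)
      (hnode _ (by linarith only [hk1, hk2]) (by linarith only [hk1, hk2]))
    have t2 := T2 (x - (k + 1) * h) (hnode _ (by linarith only [hk1, hk2]) (by linarith only [hk1, hk2])) (x - k * h)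
      (hnode _ (by linarith only [hk1, hk2]) (by linarith only [hk1, hk2]))
    rw [show x - (k - 1) * h - (x - k * h) = h by ring, abs_of_pos hh0] at t1
    rw [show x - (k + 1) * h - (x - k * h) = -h by ring, abs_neg, abs_of_pos hh0] at t2
    have t3 : |f (k - 1) - f (k + 1) - 2 * h * y1 (x - k * h)| ≤ 2 * M * h ^ 3 := by
      simp only [hf]
      rw [abs_le] at t1 t2 ⊢
      constructor <;> linarith only [t1.1, t1.2, t2.1, t2.2]
    rw [show (k : ℝ) ^ (-α) * (f (k - 1) - f (k + 1)) - 2 * h * ((k : ℝ) ^ (-α) * y1 (x - k * h))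
      = (k : ℝ) ^ (-α) * (f (k - 1) - f (k + 1) - 2 * h * y1 (x - k * h)) by ring, abs_mul,
      abs_of_nonneg (by positivity), mul_comm]
    gcongr
  have t1 := T2 (x - 1 * h) (hnode 1 (by norm_num) hν1) x hx0
  have t2 := T2 (x - 2 * h) (hnode 2 (by norm_num) (by linarith only [hν5])) x hx0
  rw [show x - 1 * h - x = -h by ring, abs_neg, abs_of_pos hh0] at t1
  rw [show x - 2 * h - x = -(2 * h) by ring, abs_neg,
    abs_of_pos (by positivity : 0 < 2 * h)] at t2
  have hf0 : f 0 = y x := by simp [hf]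
  have he2 : |-3 * f 0 + 4 * f 1 - f 2 + 2 * h * y1 x| ≤ 12 * M * h ^ 3 := by
    rw [hf0]
    simp only [hf]
    rw [abs_le] at t1 t2 ⊢
    constructor <;> linarith only [t1.1, t1.2, t2.1, t2.2]
  have he3 : |f 0 - 2 * f 1 + f 2 - h ^ 2 * y2 x| ≤ 10 * M * h ^ 3 := by
    rw [hf0]
    simp only [hf]
    rw [abs_le] at t1 t2 ⊢
    constructor <;> linarith only [t1.1, t1.2, t2.1, t2.2]
  have he4 : |f ν - f (ν - 1)| ≤ M * h ^ 2 := by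
    have := T1 (x - (ν - 1) * h) (hnode _ (by linarith only [hν1]) (by linarith only)) 0 h00
    rw [hy'0, zero_mul, sub_zero, sub_zero, show x - (ν - 1) * h = h by rw [← hνh]; ring,
      abs_of_pos hh0, abs_sub_comm] at this
    simp only [hf]
    rwa [show x - ν * h = 0 by rw [← hνh]; ring, show x - (ν - 1) * h = h by rw [← hνh]; ring]
  set e1 := S0 - 2 * h * G with he1d
  set e2 := -3 * f 0 + 4 * f 1 - f 2 + 2 * h * y1 x with he2d
  set e3 := f 0 - 2 * f 1 + f 2 - h ^ 2 * y2 x with he3d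
  set e4 := f ν - f (ν - 1) with he4d
  set E2 := h * (H * R) + h / 2 * (X * (-y1 x + y2 x * x)) - IF with hE2d
  set S3 := ∑ k ∈ Finset.Icc 3 (m + 3), (((k:ℝ) + 1) ^ (-α) - ((k:ℝ) - 1) ^ (-α)) * y (x - (k:ℝ) * h)
    with hS3
  have hab' : S0 = f 0 + (2 : ℝ) ^ (-α) * f 1 + ((3 : ℝ) ^ (-α) - 1) * f 2 + S3
      - (ν - 2) ^ (-α) * f (ν - 1) - (ν - 1) ^ (-α) * f ν := by
    have := hab
    simp only [Real.one_rpow, one_mul] at this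
    rw [show (m : ℝ) + 3 = ν - 2 by rw [hν]; ring, show (m : ℝ) + 4 = ν - 1 by rw [hν]; ring] at this
    rw [this]
    simp only [hf, one_mul]
  rw [hhα, hcap']
  have hsplit : 1 / Real.Gamma (1 - α) * (H / 2) *
          ((1 - 3 * Z0 + 2 * Z1) * y x
            + ((2:ℝ) ^ (-α) + 4 * Z0 - 4 * Z1) * y (x - h)
            + ((3:ℝ) ^ (-α) - 1 - Z0 + 2 * Z1) * y (x - 2 * h)
            + S3
            + (-((ν - 2) ^ (-α)) - 2 * W (m + 5) α) * y (x - (ν - 1) * h)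
            + (-((ν - 1) ^ (-α)) + 2 * W (m + 5) α) * y (x - ν * h))
        - 1 / Real.Gamma (1 - α) *
          (y1 x * (x * X / (1 - α)) + -y2 x * (x ^ 2 * X / (2 - α)) + IF)
      = 1 / Real.Gamma (1 - α) * (H / 2 * e1 + Z0 * (H / 2) * e2 + Z1 * H * e3 + (E0 - N / 2) * H * e4
          + y1 x * (h * H) * E0 - y2 x * (h ^ 2 * H) * E1 + E2) := by
    have hWE : W (m + 5) α = E0 - N / 2 := by rw [hW, hE0d]; ring
    have f1 : y (x - h) = f 1 := by simp [hf]
    have f2 : y (x - 2 * h) = f 2 := rfl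
    have f3 : y (x - (ν - 1) * h) = f (ν - 1) := rfl
    have f4 : y (x - ν * h) = f ν := rfl
    rw [f1, f2, f3, f4, ← hf0, hWE, mul_assoc, ← mul_sub]
    congr 1
    have s3 : S3 = S0 - (f 0 + (2 : ℝ) ^ (-α) * f 1 + ((3 : ℝ) ^ (-α) - 1) * f 2
      - (ν - 2) ^ (-α) * f (ν - 1) - (ν - 1) ^ (-α) * f ν) := by rw [hab']; ring
    have s0 : S0 = e1 + 2 * h * (y1 x * σ0 - y2 x * h * σ1 + R) := by rw [he1d, hGR]; ring
    have g0 : σ0 = E0 + ν * N / (1 - α) + Z0 - N / 2 := by rw [hE0d]; ring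
    have g1 : σ1 = E1 + ν ^ 2 * N / (2 - α) + Z1 - ν * N / 2 := by rw [hE1d]; ring
    have gIF : IF = h * (H * R) + h / 2 * (X * (-y1 x + y2 x * x)) - E2 := by rw [hE2d]; ring
    rw [s3, s0, g0, g1, gIF, he2d, he3d, he4d, ← hHN, ← hνh]
    ring
  rw [hsplit, abs_mul, abs_of_pos (by positivity : 0 < 1 / Real.Gamma (1 - α))]
  have hh2 : 0 ≤ h ^ 2 := sq_nonneg h
  have hσB : σ0 ≤ B * (ν * N) := by
    have g0 : σ0 = E0 + ν * N / (1 - α) + Z0 - N / 2 := by rw [hE0d]; ring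
    have hE0' := (le_abs_self _).trans hE0
    have hνN : 1 ≤ ν * N := by
      rw [hN, ← pw ν hν0]
      exact Real.one_le_rpow hν1 (by linarith only [hα1])
    have hNν : N / ν ≤ ν * N :=
      (div_le_self hN0.le hν1).trans (le_mul_of_one_le_left hN0.le hν1)
    have z1 : Z0 ≤ |Z0| * (ν * N) := (le_abs_self _).trans (le_mul_of_one_le_right (abs_nonneg _) hνN)
    have z2 : K0 * (N / ν) ≤ K0 * (ν * N) := by gcongr
    calc σ0 ≤ K0 * (ν * N) + ν * N / (1 - α) + |Z0| * (ν * N) + ν * N := by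
          linarith only [g0, hE0', hN0, z1, z2, hνN]
      _ = B * (ν * N) := by rw [hB]; ring
  have hσb : h ^ 3 * H * σ0 ≤ B * (x * X) * h ^ 2 := by
    calc h ^ 3 * H * σ0 ≤ h ^ 3 * H * (B * (ν * N)) := by gcongr
      _ = B * ((ν * h) * (N * H)) * h ^ 2 := by ring
      _ = _ := by rw [hνh, hHN]
  have hHx3 : H * h ^ 3 ≤ x * X * h ^ 2 := by
    calc H * h ^ 3 = h * H * h ^ 2 := by ring
      _ ≤ _ := by gcongr
  have q1 : |H / 2 * e1| ≤ M * (B * (x * X)) * h ^ 2 := by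
    rw [abs_mul, abs_of_pos (by positivity)]
    calc H / 2 * |e1| ≤ H / 2 * (2 * M * h ^ 3 * σ0) := by gcongr
      _ = M * (h ^ 3 * H * σ0) := by ring
      _ ≤ M * (B * (x * X) * h ^ 2) := by gcongr
      _ = _ := by ring
  have q2 : |Z0 * (H / 2) * e2| ≤ 6 * |Z0| * M * (x * X) * h ^ 2 := by
    rw [abs_mul, abs_mul, abs_of_pos (by positivity : 0 < H / 2)]
    calc |Z0| * (H / 2) * |e2| ≤ |Z0| * (H / 2) * (12 * M * h ^ 3) := by gcongr
      _ = 6 * |Z0| * M * (H * h ^ 3) := by ring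
      _ ≤ 6 * |Z0| * M * (x * X * h ^ 2) := by gcongr
      _ = _ := by ring
  have q3 : |Z1 * H * e3| ≤ 10 * |Z1| * M * (x * X) * h ^ 2 := by
    rw [abs_mul, abs_mul, abs_of_pos hH0]
    calc |Z1| * H * |e3| ≤ |Z1| * H * (10 * M * h ^ 3) := by gcongr
      _ = 10 * |Z1| * M * (H * h ^ 3) := by ring
      _ ≤ 10 * |Z1| * M * (x * X * h ^ 2) := by gcongr
      _ = _ := by ring
  have hE0N : |E0| ≤ K0 * N := hE0.trans (by
    gcongr
    exact div_le_self hN0.le hν1)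
  have q4 : |(E0 - N / 2) * H * e4| ≤ (K0 + 1) * M * X * h ^ 2 := by
    have : |E0 - N / 2| ≤ (K0 + 1) * N := by
      refine (abs_sub _ _).trans ?_
      rw [abs_of_pos (by positivity : 0 < N / 2)]
      linarith only [hE0N, hN0]
    rw [abs_mul, abs_mul, abs_of_pos hH0]
    calc |E0 - N / 2| * H * |e4| ≤ (K0 + 1) * N * H * (M * h ^ 2) := by gcongr
      _ = (K0 + 1) * M * (N * H) * h ^ 2 := by ring
      _ = _ := by rw [hHN]
  have q5 : |y1 x * (h * H) * E0| ≤ |y1 x| * K0 * (X / x) * h ^ 2 := by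
    rw [abs_mul, abs_mul, abs_of_pos (by positivity : 0 < h * H)]
    calc |y1 x| * (h * H) * |E0| ≤ |y1 x| * (h * H) * (K0 * (N / ν)) := by gcongr
      _ = |y1 x| * K0 * (X / x) * h ^ 2 := by
        rw [← hHN, ← hνh]
        field_simp
  have q6 : |y2 x * (h ^ 2 * H) * E1| ≤ |y2 x| * K1 * X * h ^ 2 := by
    rw [abs_mul, abs_mul, abs_of_pos (by positivity : 0 < h ^ 2 * H)]
    calc |y2 x| * (h ^ 2 * H) * |E1| ≤ |y2 x| * (h ^ 2 * H) * (K1 * N) := by gcongr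
      _ = |y2 x| * K1 * (N * H) * h ^ 2 := by ring
      _ = _ := by rw [hHN]
  have q7 : |E2| ≤ (2 * M * (x * X) + 5 * M * (B * (x * X))) * h ^ 2 := by
    refine hem.trans ?_
    calc 2 * M * (h ^ 3 * H) + 5 * M * (h ^ 3 * H) * σ0
        = 2 * M * (H * h ^ 3) + 5 * M * (h ^ 3 * H * σ0) := by ring
      _ ≤ 2 * M * (x * X * h ^ 2) + 5 * M * (B * (x * X) * h ^ 2) := by gcongr
      _ = _ := by ring
  have qtot : |H / 2 * e1 + Z0 * (H / 2) * e2 + Z1 * H * e3 + (E0 - N / 2) * H * e4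
      + y1 x * (h * H) * E0 - y2 x * (h ^ 2 * H) * E1 + E2| ≤ D * h ^ 2 := by
    have hDe : D * h ^ 2 = M * (B * (x * X)) * h ^ 2 + 6 * |Z0| * M * (x * X) * h ^ 2
      + 10 * |Z1| * M * (x * X) * h ^ 2 + (K0 + 1) * M * X * h ^ 2
      + |y1 x| * K0 * (X / x) * h ^ 2 + |y2 x| * K1 * X * h ^ 2
      + (2 * M * (x * X) + 5 * M * (B * (x * X))) * h ^ 2 := by rw [hD]; ring
    rw [hDe]
    rw [abs_le] at q1 q2 q3 q4 q5 q6 q7 ⊢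
    constructor <;> linarith only [q1.1, q1.2, q2.1, q2.2, q3.1, q3.2, q4.1, q4.2, q5.1, q5.2,
      q6.1, q6.2, q7.1, q7.2]
  calc _ ≤ 1 / Real.Gamma (1 - α) * (D * h ^ 2) := by gcongr
    _ ≤ (1 / Real.Gamma (1 - α) * D + 1) * h ^ 2 := by linarith only [hh2]
end
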